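/- arXiv:1112.1818 — 2 statements merged into one kernel-verified Lean document; each statement's English description precedes it below -/
import Mathlib

section
/- (ε-regularity, Proposition 2.1) For every dimension n ≥ 1 and every p ∈ (1,2) there exist constants ε₀ > 0 and C > 0 with the following property: if f : ℝ² → ℝⁿ is smooth on a neighborhood of the closed unit disk D, Δf(z) = 0 at every point z ∈ D where ∇f(z) = 0, and the Willmore energy satisfies W(f, D) < ε₀², then (∫_{D_{1/2}} (|∇f|^p + |∇²f|^p))^{1/p} ≤ C (∫_D |∇f|²)^{1/2}. -/
open MeasureTheory Set Filter
open scoped ENNReal Real RealInnerProductSpace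

/-- Partial derivative in the first coordinate direction. -/
noncomputable def pd1 {n : ℕ} (f : ℝ × ℝ → EuclideanSpace ℝ (Fin n)) (z : ℝ × ℝ) :
    EuclideanSpace ℝ (Fin n) := fderiv ℝ f z (1, 0)

/-- Partial derivative in the second coordinate direction. -/
noncomputable def pd2 {n : ℕ} (f : ℝ × ℝ → EuclideanSpace ℝ (Fin n)) (z : ℝ × ℝ) :
    EuclideanSpace ℝ (Fin n) := fderiv ℝ f z (0, 1)

/-- `|∇f|²`. -/
noncomputable def gradSq {n : ℕ} (f : ℝ × ℝ → EuclideanSpace ℝ (Fin n)) (z : ℝ × ℝ) : ℝ :=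
    ‖pd1 f z‖ ^ 2 + ‖pd2 f z‖ ^ 2

/-- The Laplacian `Δf = ∂²f/∂x² + ∂²f/∂y²`. -/
noncomputable def lap {n : ℕ} (f : ℝ × ℝ → EuclideanSpace ℝ (Fin n)) (z : ℝ × ℝ) :
    EuclideanSpace ℝ (Fin n) := pd1 (pd1 f) z + pd2 (pd2 f) z

/-- The Willmore energy `W(f, Ω) = ∫_{Ω ∩ {∇f ≠ 0}} |Δf|²/|∇f|²`. -/
noncomputable def willmore {n : ℕ} (f : ℝ × ℝ → EuclideanSpace ℝ (Fin n))
    (Ω : Set (ℝ × ℝ)) : ℝ≥0∞ :=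
  ∫⁻ z in Ω ∩ {w | gradSq f w ≠ 0}, ENNReal.ofReal (‖lap f z‖ ^ 2 / gradSq f z)

/-- The open disk of radius `r` centered at the origin of `ℝ²`. -/
def disk (r : ℝ) : Set (ℝ × ℝ) := {z | z.1 ^ 2 + z.2 ^ 2 < r ^ 2}

/-- The closed disk of radius `r` centered at the origin of `ℝ²`. -/
def closedDisk (r : ℝ) : Set (ℝ × ℝ) := {z | z.1 ^ 2 + z.2 ^ 2 ≤ r ^ 2}

section Fields

variable {n : ℕ}

/-- `|a|² + |b|²` for a pair of vector fields. -/
noncomputable def pairSq (a b : ℝ × ℝ → EuclideanSpace ℝ (Fin n)) (z : ℝ × ℝ) : ℝ :=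
  ‖a z‖ ^ 2 + ‖b z‖ ^ 2

/-- The full squared gradient of a pair of vector fields. -/
noncomputable def pairGradSq (a b : ℝ × ℝ → EuclideanSpace ℝ (Fin n)) (z : ℝ × ℝ) : ℝ :=
  ‖pd1 a z‖ ^ 2 + ‖pd2 a z‖ ^ 2 + ‖pd1 b z‖ ^ 2 + ‖pd2 b z‖ ^ 2

/-- `|∂̄h|²` for `h = a - i b` (with `∂̄ = ∂₁ + i ∂₂`): the squared divergence and curl. -/
noncomputable def dbarSq (a b : ℝ × ℝ → EuclideanSpace ℝ (Fin n)) (z : ℝ × ℝ) : ℝ :=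
  ‖pd1 a z + pd2 b z‖ ^ 2 + ‖pd2 a z - pd1 b z‖ ^ 2

/-- `|∂h|²` for `h = a - i b` (with `∂ = ∂₁ - i ∂₂`). -/
noncomputable def dSq (a b : ℝ × ℝ → EuclideanSpace ℝ (Fin n)) (z : ℝ × ℝ) : ℝ :=
  ‖pd1 a z - pd2 b z‖ ^ 2 + ‖pd2 a z + pd1 b z‖ ^ 2

variable {a b : ℝ × ℝ → EuclideanSpace ℝ (Fin n)}

lemma pairSq_nonneg (z : ℝ × ℝ) : 0 ≤ pairSq a b z := by unfold pairSq; positivity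

lemma pairGradSq_nonneg (z : ℝ × ℝ) : 0 ≤ pairGradSq a b z := by unfold pairGradSq; positivity

lemma dbarSq_nonneg (z : ℝ × ℝ) : 0 ≤ dbarSq a b z := by unfold dbarSq; positivity

lemma dSq_nonneg (z : ℝ × ℝ) : 0 ≤ dSq a b z := by unfold dSq; positivity

lemma dSq_add_dbarSq (z : ℝ × ℝ) : dSq a b z + dbarSq a b z = 2 * pairGradSq a b z := by
  simp only [dSq, dbarSq, pairGradSq, norm_add_sq_real, norm_sub_sq_real]; ring

lemma contDiff_pd1 {m k : WithTop ℕ∞} (ha : ContDiff ℝ m a) (hk : k + 1 ≤ m) :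
    ContDiff ℝ k (pd1 a) :=
  (ha.fderiv_right hk).clm_apply contDiff_const

lemma contDiff_pd2 {m k : WithTop ℕ∞} (ha : ContDiff ℝ m a) (hk : k + 1 ≤ m) :
    ContDiff ℝ k (pd2 a) :=
  (ha.fderiv_right hk).clm_apply contDiff_const

lemma contDiff_pairSq {m : WithTop ℕ∞} (ha : ContDiff ℝ m a) (hb : ContDiff ℝ m b) :
    ContDiff ℝ m (pairSq a b) :=
  (ha.norm_sq ℝ).add (hb.norm_sq ℝ)

lemma continuous_pairGradSq (ha : ContDiff ℝ 2 a) (hb : ContDiff ℝ 2 b) :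
    Continuous (pairGradSq a b) := by
  have h1 := (contDiff_pd1 (k := 1) ha (by norm_num)).continuous
  have h2 := (contDiff_pd2 (k := 1) ha (by norm_num)).continuous
  have h3 := (contDiff_pd1 (k := 1) hb (by norm_num)).continuous
  have h4 := (contDiff_pd2 (k := 1) hb (by norm_num)).continuous
  unfold pairGradSq; fun_prop

lemma continuous_dbarSq (ha : ContDiff ℝ 2 a) (hb : ContDiff ℝ 2 b) :
    Continuous (dbarSq a b) := by
  have h1 := (contDiff_pd1 (k := 1) ha (by norm_num)).continuous
  have h2 := (contDiff_pd2 (k := 1) ha (by norm_num)).continuous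
  have h3 := (contDiff_pd1 (k := 1) hb (by norm_num)).continuous
  have h4 := (contDiff_pd2 (k := 1) hb (by norm_num)).continuous
  unfold dbarSq; fun_prop

lemma continuous_dSq (ha : ContDiff ℝ 2 a) (hb : ContDiff ℝ 2 b) :
    Continuous (dSq a b) := by
  have h1 := (contDiff_pd1 (k := 1) ha (by norm_num)).continuous
  have h2 := (contDiff_pd2 (k := 1) ha (by norm_num)).continuous
  have h3 := (contDiff_pd1 (k := 1) hb (by norm_num)).continuous
  have h4 := (contDiff_pd2 (k := 1) hb (by norm_num)).continuous
  unfold dSq; fun_prop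

/-- The integral of a directional derivative of a compactly supported function vanishes. -/
lemma integral_fderiv_apply_eq_zero {g : ℝ × ℝ → ℝ} (hg : ContDiff ℝ 1 g)
    (hc : HasCompactSupport g) (v : ℝ × ℝ) : ∫ z, fderiv ℝ g z v = 0 := by
  have hint : Integrable (fun z => fderiv ℝ g z v) :=
    ((hg.continuous_fderiv (by norm_num)).clm_apply continuous_const).integrable_of_hasCompactSupport
      (hc.fderiv_apply ℝ v)
  have h := integral_mul_fderiv_eq_neg_fderiv_mul_of_integrable (μ := volume)
    (f := fun _ : ℝ × ℝ => (1 : ℝ)) (g := g) (v := v) (by simp) (by simpa using hint)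
    (by simpa using hg.continuous.integrable_of_hasCompactSupport hc)
    (fun x _ => by fun_prop) (fun x _ => (hg.differentiable (by norm_num)) x)
  simpa using h

/-- Complex Cauchy–Schwarz, written with real vectors. -/
lemma sq_add_sq_inner_le {E : Type*} [NormedAddCommGroup E] [InnerProductSpace ℝ E]
    (x y P Q : E) :
    (⟪P, x⟫ + ⟪Q, y⟫) ^ 2 + (⟪P, y⟫ - ⟪Q, x⟫) ^ 2
      ≤ (‖x‖ ^ 2 + ‖y‖ ^ 2) * (‖P‖ ^ 2 + ‖Q‖ ^ 2) := by
  set u := ⟪P, x⟫ + ⟪Q, y⟫ with hu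
  set v := ⟪P, y⟫ - ⟪Q, x⟫ with hv
  have key : u ^ 2 + v ^ 2 = ⟪P, u • x + v • y⟫ + ⟪Q, u • y - v • x⟫ := by
    simp only [inner_add_right, inner_sub_right, real_inner_smul_right]
    rw [hu, hv]; ring
  have h1 := abs_le.1 (abs_real_inner_le_norm P (u • x + v • y))
  have h2 := abs_le.1 (abs_real_inner_le_norm Q (u • y - v • x))
  have hn : ‖u • x + v • y‖ ^ 2 + ‖u • y - v • x‖ ^ 2 = (u ^ 2 + v ^ 2) * (‖x‖ ^ 2 + ‖y‖ ^ 2) := by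
    rw [norm_add_sq_real, norm_sub_sq_real]
    simp only [norm_smul, mul_pow, real_inner_smul_left, real_inner_smul_right, Real.norm_eq_abs,
      sq_abs, real_inner_comm y x]
    ring
  set p := ‖P‖
  set q := ‖Q‖
  set r := ‖u • x + v • y‖
  set s := ‖u • y - v • x‖
  have h3 : u ^ 2 + v ^ 2 ≤ p * r + q * s := by rw [key]; linarith
  have h4 : (p * r + q * s) ^ 2 ≤ (p ^ 2 + q ^ 2) * (r ^ 2 + s ^ 2) := by
    nlinarith [sq_nonneg (p * s - q * r)]
  rcases (by positivity : 0 ≤ u ^ 2 + v ^ 2).eq_or_lt with h0 | h0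
  · rw [← h0]; positivity
  have h5 : (u ^ 2 + v ^ 2) ^ 2 ≤ (p ^ 2 + q ^ 2) * (r ^ 2 + s ^ 2) :=
    (pow_le_pow_left₀ h0.le h3 2).trans h4
  rw [hn] at h5
  exact le_of_mul_le_mul_left (by nlinarith) h0

lemma fderiv_pd1_comm (ha : ContDiff ℝ 2 a) (z : ℝ × ℝ) :
    fderiv ℝ (pd1 a) z (0, 1) = fderiv ℝ (pd2 a) z (1, 0) := by
  have hd : DifferentiableAt ℝ (fderiv ℝ a) z :=
    (ha.fderiv_right (m := 1) (by norm_num)).differentiable (by norm_num) z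
  have hs : IsSymmSndFDerivAt ℝ a z := ha.contDiffAt.isSymmSndFDerivAt (by simp)
  have e (v : ℝ × ℝ) (w : ℝ × ℝ) :
      fderiv ℝ (fun y => fderiv ℝ a y v) z w = fderiv ℝ (fderiv ℝ a) z w v := by
    rw [fderiv_clm_apply hd (by fun_prop)]; simp
  change fderiv ℝ (fun y => fderiv ℝ a y (1, 0)) z _ = fderiv ℝ (fun y => fderiv ℝ a y (0, 1)) z _
  rw [e, e]; exact hs _ _

lemma fderiv_pairSq (ha : ContDiff ℝ 2 a) (hb : ContDiff ℝ 2 b) (z v : ℝ × ℝ) :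
    fderiv ℝ (pairSq a b) z v = 2 * (⟪a z, fderiv ℝ a z v⟫ + ⟪b z, fderiv ℝ b z v⟫) := by
  have h1 := (ha.differentiable (by norm_num) z).hasFDerivAt.norm_sq
  have h2 := (hb.differentiable (by norm_num) z).hasFDerivAt.norm_sq
  have h3 : HasFDerivAt (pairSq a b) _ z := h1.add h2
  rw [h3.fderiv]
  simp; ring

lemma fderiv_weight_mul {c d : ℝ × ℝ → EuclideanSpace ℝ (Fin n)} {l : ℝ} (hl : 0 < l)
    (ha : ContDiff ℝ 2 a) (hb : ContDiff ℝ 2 b)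
    (hc : ContDiff ℝ 1 c) (hd : ContDiff ℝ 1 d) (z v : ℝ × ℝ) :
    fderiv ℝ (fun z => l * (l + pairSq a b z)⁻¹ * (⟪a z, c z⟫ - ⟪b z, d z⟫)) z v =
      l * (l + pairSq a b z)⁻¹ * (⟪a z, fderiv ℝ c z v⟫ + ⟪fderiv ℝ a z v, c z⟫
        - (⟪b z, fderiv ℝ d z v⟫ + ⟪fderiv ℝ b z v, d z⟫))
      - l * ((l + pairSq a b z) ^ 2)⁻¹ * (2 * (⟪a z, fderiv ℝ a z v⟫ + ⟪b z, fderiv ℝ b z v⟫)) *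
        (⟪a z, c z⟫ - ⟪b z, d z⟫) := by
  have hpos : l + pairSq a b z ≠ 0 := by have := pairSq_nonneg (a := a) (b := b) z; positivity
  have ha' := (ha.differentiable (by norm_num) z).hasFDerivAt
  have hb' := (hb.differentiable (by norm_num) z).hasFDerivAt
  have hc' := (hc.differentiable (by norm_num) z).hasFDerivAt
  have hd' := (hd.differentiable (by norm_num) z).hasFDerivAt
  have hr := ((contDiff_pairSq ha hb).differentiable (by norm_num) z).hasFDerivAt
  have hw := (((hasDerivAt_inv hpos).comp_hasFDerivAt z (hr.const_add l)).const_mul l)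
  have h := hw.mul ((ha'.inner ℝ hc').sub (hb'.inner ℝ hd'))
  have h' := h.fderiv
  simp only [Function.comp_def] at h'
  erw [h']
  simp [fderiv_pairSq ha hb]
  ring

lemma weighted_dSq_le (ha : ContDiff ℝ 2 a) (hb : ContDiff ℝ 2 b) {l : ℝ} (hl : 0 < l)
    (z : ℝ × ℝ) :
    (l * (l + pairSq a b z)⁻¹) ^ 2 * dSq a b z - l * (l + pairSq a b z)⁻¹ * dbarSq a b z ≤
      2 * (fderiv ℝ (fun z => l * (l + pairSq a b z)⁻¹ *
          (⟪a z, pd1 b z⟫ - ⟪b z, pd1 a z⟫)) z (0, 1)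
        - fderiv ℝ (fun z => l * (l + pairSq a b z)⁻¹ *
          (⟪a z, pd2 b z⟫ - ⟪b z, pd2 a z⟫)) z (1, 0)) := by
  rw [fderiv_weight_mul hl ha hb (contDiff_pd1 hb (by norm_num)) (contDiff_pd1 ha (by norm_num)),
    fderiv_weight_mul hl ha hb (contDiff_pd2 hb (by norm_num)) (contDiff_pd2 ha (by norm_num)),
    fderiv_pd1_comm ha, fderiv_pd1_comm hb]
  have e1 (c : ℝ × ℝ → EuclideanSpace ℝ (Fin n)) : fderiv ℝ c z (1, 0) = pd1 c z := rfl
  have e2 (c : ℝ × ℝ → EuclideanSpace ℝ (Fin n)) : fderiv ℝ c z (0, 1) = pd2 c z := rfl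
  rw [e1 a, e1 b, e2 a, e2 b]
  have hr := pairSq_nonneg (a := a) (b := b) z
  have hA := sq_add_sq_inner_le (a z) (b z) (pd1 a z - pd2 b z) (pd2 a z + pd1 b z)
  set B := (⟪pd1 a z + pd2 b z, a z⟫ - ⟪pd2 a z - pd1 b z, b z⟫) ^ 2 +
    (⟪pd1 a z + pd2 b z, b z⟫ + ⟪pd2 a z - pd1 b z, a z⟫) ^ 2 with hB
  set A := (⟪pd1 a z - pd2 b z, a z⟫ + ⟪pd2 a z + pd1 b z, b z⟫) ^ 2 +
    (⟪pd1 a z - pd2 b z, b z⟫ - ⟪pd2 a z + pd1 b z, a z⟫) ^ 2 with hA'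
  change A ≤ pairSq a b z * dSq a b z at hA
  have hB0 : 0 ≤ B := by positivity
  set r := pairSq a b z
  have hs : 0 < l + r := by positivity
  set w := (l + r)⁻¹ with hw
  have hw1 : w * (l + r) = 1 := inv_mul_cancel₀ hs.ne'
  have hw2 : ((l + r) ^ 2)⁻¹ = w ^ 2 := by rw [hw, inv_pow]
  have hw0 : 0 < w := by positivity
  rw [hw2]
  have hPQ : dSq a b z - dbarSq a b z
      = 4 * (⟪pd2 a z, pd1 b z⟫ - ⟪pd1 a z, pd2 b z⟫) := by
    simp only [dSq, dbarSq, norm_add_sq_real, norm_sub_sq_real]; ring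
  have hAB : A - B = 4 * ((⟪a z, pd2 a z⟫ + ⟪b z, pd2 b z⟫) * (⟪a z, pd1 b z⟫ - ⟪b z, pd1 a z⟫)
      - (⟪a z, pd1 a z⟫ + ⟪b z, pd1 b z⟫) * (⟪a z, pd2 b z⟫ - ⟪b z, pd2 a z⟫)) := by
    rw [hB, hA']
    simp only [real_inner_comm (a z), real_inner_comm (b z), inner_add_right, inner_sub_right]
    ring
  have hc1 := real_inner_comm (pd1 b z) (pd2 a z)
  have hc2 := real_inner_comm (pd2 b z) (pd1 a z)
  have main : l * w * (dSq a b z - dbarSq a b z) - l * w ^ 2 * (A - B) ≥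
      (l * w) ^ 2 * dSq a b z - l * w * dbarSq a b z := by
    have h1 : l * w ^ 2 * A ≤ l * w ^ 2 * (r * dSq a b z) :=
      mul_le_mul_of_nonneg_left hA (by positivity)
    have h2 : 0 ≤ l * w ^ 2 * B := by positivity
    have h3 : l * w * dSq a b z = l * w * (w * (l + r)) * dSq a b z := by rw [hw1]; ring
    nlinarith
  refine main.le.trans (le_of_eq ?_)
  rw [hPQ, hAB, hc1.symm, hc2.symm]
  ring

lemma fderiv_eq_zero_of_notMem_tsupport {z : ℝ × ℝ} (hz : z ∉ tsupport a) : fderiv ℝ a z = 0 :=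
  Function.notMem_support.1 fun h => hz (support_fderiv_subset ℝ h)

lemma dSq_eq_zero {z : ℝ × ℝ} (hz : z ∉ tsupport a ∪ tsupport b) : dSq a b z = 0 := by
  simp [dSq, pd1, pd2, fderiv_eq_zero_of_notMem_tsupport (fun h => hz (Or.inl h)),
    fderiv_eq_zero_of_notMem_tsupport (fun h => hz (Or.inr h))]

lemma dbarSq_eq_zero {z : ℝ × ℝ} (hz : z ∉ tsupport a ∪ tsupport b) : dbarSq a b z = 0 := by
  simp [dbarSq, pd1, pd2, fderiv_eq_zero_of_notMem_tsupport (fun h => hz (Or.inl h)),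
    fderiv_eq_zero_of_notMem_tsupport (fun h => hz (Or.inr h))]

lemma contDiff_weight {m : WithTop ℕ∞} (ha : ContDiff ℝ m a) (hb : ContDiff ℝ m b) {l : ℝ}
    (hl : 0 < l) : ContDiff ℝ m (fun z => l * (l + pairSq a b z)⁻¹) :=
  contDiff_const.mul ((contDiff_const.add (contDiff_pairSq ha hb)).inv fun z =>
    (add_pos_of_pos_of_nonneg hl (pairSq_nonneg z)).ne')

lemma integrable_weight_mul_dSq (ha : ContDiff ℝ 2 a) (hb : ContDiff ℝ 2 b)
    (hac : HasCompactSupport a) (hbc : HasCompactSupport b) {l : ℝ} (hl : 0 < l) :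
    Integrable (fun z => (l * (l + pairSq a b z)⁻¹) ^ 2 * dSq a b z) := by
  refine (((contDiff_weight ha hb hl).continuous.pow 2).mul
    (continuous_dSq ha hb)).integrable_of_hasCompactSupport
    (.intro' (hac.isCompact.union hbc.isCompact)
      ((isClosed_tsupport a).union (isClosed_tsupport b)) fun z hz => ?_)
  simp [dSq_eq_zero hz]

lemma integrable_weight_mul_dbarSq (ha : ContDiff ℝ 2 a) (hb : ContDiff ℝ 2 b)
    (hac : HasCompactSupport a) (hbc : HasCompactSupport b) {l : ℝ} (hl : 0 < l) :
    Integrable (fun z => l * (l + pairSq a b z)⁻¹ * dbarSq a b z) := by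
  refine ((contDiff_weight ha hb hl).continuous.mul
    (continuous_dbarSq ha hb)).integrable_of_hasCompactSupport
    (.intro' (hac.isCompact.union hbc.isCompact)
      ((isClosed_tsupport a).union (isClosed_tsupport b)) fun z hz => ?_)
  simp [dbarSq_eq_zero hz]

/-- The null Lagrangian estimate: a weighted `L²` bound of `∂h` by `∂̄h` for compactly supported
`h = a - i b`, with the weights adapted to `h` itself. -/
lemma integral_dSq_le (ha : ContDiff ℝ 2 a) (hb : ContDiff ℝ 2 b)
    (hac : HasCompactSupport a) (hbc : HasCompactSupport b) {l : ℝ} (hl : 0 < l) :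
    ∫ z, (l * (l + pairSq a b z)⁻¹) ^ 2 * dSq a b z
      ≤ ∫ z, l * (l + pairSq a b z)⁻¹ * dbarSq a b z := by
  have hw : ContDiff ℝ 1 (fun z => l * (l + pairSq a b z)⁻¹) :=
    (contDiff_weight ha hb hl).of_le (by norm_num)
  have hK : IsCompact (tsupport a ∪ tsupport b) ∧ IsClosed (tsupport a ∪ tsupport b) :=
    ⟨hac.isCompact.union hbc.isCompact, (isClosed_tsupport a).union (isClosed_tsupport b)⟩
  have hV {c d : ℝ × ℝ → EuclideanSpace ℝ (Fin n)} (hc : ContDiff ℝ 1 c) (hd : ContDiff ℝ 1 d) :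
      ContDiff ℝ 1 (fun z => l * (l + pairSq a b z)⁻¹ * (⟪a z, c z⟫ - ⟪b z, d z⟫)) :=
    hw.mul (((ha.of_le (by norm_num)).inner ℝ hc).sub ((hb.of_le (by norm_num)).inner ℝ hd))
  have hVc (c d : ℝ × ℝ → EuclideanSpace ℝ (Fin n)) :
      HasCompactSupport (fun z => l * (l + pairSq a b z)⁻¹ * (⟪a z, c z⟫ - ⟪b z, d z⟫)) := by
    refine .intro' hK.1 hK.2 fun z hz => ?_
    have hza := image_eq_zero_of_notMem_tsupport (fun h => hz (Or.inl h))
    have hzb := image_eq_zero_of_notMem_tsupport (fun h => hz (Or.inr h))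
    simp [hza, hzb]
  have hV1 := hV (contDiff_pd1 hb (k := 1) (by norm_num)) (contDiff_pd1 ha (k := 1) (by norm_num))
  have hV2 := hV (contDiff_pd2 hb (k := 1) (by norm_num)) (contDiff_pd2 ha (k := 1) (by norm_num))
  have hi {g : ℝ × ℝ → ℝ} (hg : ContDiff ℝ 1 g) (hc : HasCompactSupport g) (v : ℝ × ℝ) :
      Integrable (fun z => fderiv ℝ g z v) :=
    ((hg.continuous_fderiv (by norm_num)).clm_apply continuous_const).integrable_of_hasCompactSupport
      (hc.fderiv_apply ℝ v)
  have hI1 := integrable_weight_mul_dSq ha hb hac hbc hl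
  have hI2 := integrable_weight_mul_dbarSq ha hb hac hbc hl
  have h := integral_mono (hI1.sub hI2)
    (((hi hV1 (hVc _ _) (0, 1)).sub (hi hV2 (hVc _ _) (1, 0))).const_mul 2)
    (weighted_dSq_le ha hb hl)
  simp only [Pi.sub_apply] at h
  rw [integral_sub hI1 hI2, integral_const_mul, integral_sub (hi hV1 (hVc _ _) _)
    (hi hV2 (hVc _ _) _), integral_fderiv_apply_eq_zero hV1 (hVc _ _),
    integral_fderiv_apply_eq_zero hV2 (hVc _ _)] at h
  linarith

/-- The energy of `h = a - i b` on the sublevel set `{|h|² ≤ l}` is controlled by `∂̄h`. -/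
lemma lintegral_pairGradSq_sublevel_le (ha : ContDiff ℝ 2 a) (hb : ContDiff ℝ 2 b)
    (hac : HasCompactSupport a) (hbc : HasCompactSupport b) {l : ℝ} (hl : 0 < l) :
    ∫⁻ z in {z | pairSq a b z ≤ l}, ENNReal.ofReal (pairGradSq a b z)
      ≤ 4 * ∫⁻ z, ENNReal.ofReal (l * (l + pairSq a b z)⁻¹ * dbarSq a b z) := by
  have hpos (z : ℝ × ℝ) : 0 < l + pairSq a b z := by
    have := pairSq_nonneg (a := a) (b := b) z; positivity
  have hI1 := integrable_weight_mul_dSq ha hb hac hbc hl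
  have hI2 := integrable_weight_mul_dbarSq ha hb hac hbc hl
  have hn2 : ∀ z, 0 ≤ l * (l + pairSq a b z)⁻¹ * dbarSq a b z := fun z =>
    mul_nonneg (mul_nonneg hl.le (inv_nonneg.2 (hpos z).le)) (dbarSq_nonneg z)
  have hn1 : ∀ z, 0 ≤ (l * (l + pairSq a b z)⁻¹) ^ 2 * dSq a b z := fun z =>
    mul_nonneg (sq_nonneg _) (dSq_nonneg z)
  have hle : ∀ z ∈ {z | pairSq a b z ≤ l}, ENNReal.ofReal (pairGradSq a b z) ≤
      ENNReal.ofReal (2 * ((l * (l + pairSq a b z)⁻¹) ^ 2 * dSq a b z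
        + l * (l + pairSq a b z)⁻¹ * dbarSq a b z)) := by
    intro z hz
    refine ENNReal.ofReal_le_ofReal ?_
    have hz' : pairSq a b z ≤ l := hz
    have hw : 1 / 2 ≤ l * (l + pairSq a b z)⁻¹ := by
      rw [← div_eq_mul_inv, div_le_div_iff₀ two_pos (hpos z)]; linarith
    have h1 := dSq_add_dbarSq (a := a) (b := b) z
    have h2 := dSq_nonneg (a := a) (b := b) z
    have h3 := dbarSq_nonneg (a := a) (b := b) z
    have h4 : 1 / 4 * dSq a b z ≤ (l * (l + pairSq a b z)⁻¹) ^ 2 * dSq a b z :=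
      mul_le_mul_of_nonneg_right (by nlinarith) h2
    have h5 : 1 / 4 * dbarSq a b z ≤ l * (l + pairSq a b z)⁻¹ * dbarSq a b z :=
      mul_le_mul_of_nonneg_right (by linarith) h3
    linarith
  have hmeas : MeasurableSet {z | pairSq a b z ≤ l} :=
    (isClosed_le (contDiff_pairSq ha hb).continuous continuous_const).measurableSet
  calc _ ≤ ∫⁻ z, ENNReal.ofReal (2 * ((l * (l + pairSq a b z)⁻¹) ^ 2 * dSq a b z
        + l * (l + pairSq a b z)⁻¹ * dbarSq a b z)) :=
        (setLIntegral_mono' hmeas hle).trans (setLIntegral_le_lintegral _ _)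
    _ = ENNReal.ofReal (∫ z, 2 * ((l * (l + pairSq a b z)⁻¹) ^ 2 * dSq a b z
        + l * (l + pairSq a b z)⁻¹ * dbarSq a b z)) :=
        (ofReal_integral_eq_lintegral_ofReal ((hI1.add hI2).const_mul 2)
          (.of_forall fun z => mul_nonneg two_pos.le (add_nonneg (hn1 z) (hn2 z)))).symm
    _ ≤ ENNReal.ofReal (4 * ∫ z, l * (l + pairSq a b z)⁻¹ * dbarSq a b z) := by
        refine ENNReal.ofReal_le_ofReal ?_
        rw [integral_const_mul, integral_add hI1 hI2]
        linarith [integral_dSq_le ha hb hac hbc hl]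
    _ = _ := by
        rw [ENNReal.ofReal_mul (by norm_num), ofReal_integral_eq_lintegral_ofReal hI2
          (.of_forall hn2)]
        norm_num

end Fields

section LevelSets

lemma deriv_smoothTransition_eq_zero {x : ℝ} (hx : x ≤ 0 ∨ 1 ≤ x) :
    deriv Real.smoothTransition x = 0 := by
  rcases hx with hx | hx
  · refine IsLocalMin.deriv_eq_zero (.of_forall fun y => ?_)
    rw [Real.smoothTransition.zero_of_nonpos hx]
    exact Real.smoothTransition.nonneg y
  · refine IsLocalMax.deriv_eq_zero (.of_forall fun y => ?_)
    rw [Real.smoothTransition.one_of_one_le hx]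
    exact Real.smoothTransition.le_one y

lemma exists_deriv_smoothTransition_bound :
    ∃ M > (0 : ℝ), ∀ x, |deriv Real.smoothTransition x| ≤ M := by
  have hc : Continuous (deriv Real.smoothTransition) :=
    (Real.smoothTransition.contDiff (n := 1)).continuous_deriv (by norm_num)
  obtain ⟨M, hM⟩ := (isCompact_Icc (a := (0 : ℝ)) (b := 1)).exists_bound_of_continuousOn
    hc.continuousOn
  refine ⟨max M 1, by positivity, fun x => ?_⟩
  by_cases hx : x ∈ Icc (0 : ℝ) 1
  · exact (hM x hx).trans (le_max_left _ _)
  · rw [deriv_smoothTransition_eq_zero, abs_zero]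
    · positivity
    · rw [mem_Icc, not_and_or, not_le, not_le] at hx
      exact hx.imp le_of_lt le_of_lt

variable {n : ℕ} {a b : ℝ × ℝ → EuclideanSpace ℝ (Fin n)}

lemma norm_le_of_prod_basis {F : Type*} [NormedAddCommGroup F] [NormedSpace ℝ F]
    (L : ℝ × ℝ →L[ℝ] F) : ‖L‖ ≤ ‖L (1, 0)‖ + ‖L (0, 1)‖ := by
  refine L.opNorm_le_bound (by positivity) fun v => ?_
  have hv : v = v.1 • ((1 : ℝ), (0 : ℝ)) + v.2 • ((0 : ℝ), (1 : ℝ)) := by ext <;> simp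
  have h1 : |v.1| ≤ ‖v‖ := norm_fst_le v
  have h2 : |v.2| ≤ ‖v‖ := norm_snd_le v
  calc ‖L v‖ = ‖v.1 • L (1, 0) + v.2 • L (0, 1)‖ := by
        conv_lhs => rw [hv]
        rw [map_add, map_smul, map_smul]
    _ ≤ |v.1| * ‖L (1, 0)‖ + |v.2| * ‖L (0, 1)‖ := by
        refine (norm_add_le _ _).trans ?_
        rw [norm_smul, norm_smul, Real.norm_eq_abs, Real.norm_eq_abs]
    _ ≤ ‖v‖ * ‖L (1, 0)‖ + ‖v‖ * ‖L (0, 1)‖ := by gcongr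
    _ = _ := by ring

lemma norm_fderiv_pairSq_le (ha : ContDiff ℝ 2 a) (hb : ContDiff ℝ 2 b) (z : ℝ × ℝ) :
    ‖fderiv ℝ (pairSq a b) z‖ ≤ 4 * (√(pairSq a b z) * √(pairGradSq a b z)) := by
  have key (v : ℝ × ℝ) (hv : ‖fderiv ℝ a z v‖ ^ 2 + ‖fderiv ℝ b z v‖ ^ 2 ≤ pairGradSq a b z) :
      ‖fderiv ℝ (pairSq a b) z v‖ ≤ 2 * (√(pairSq a b z) * √(pairGradSq a b z)) := by
    rw [fderiv_pairSq ha hb, Real.norm_eq_abs, abs_mul, abs_two,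
      ← Real.sqrt_mul (pairSq_nonneg z)]
    gcongr
    refine Real.abs_le_sqrt ?_
    have h1 := abs_real_inner_le_norm (a z) (fderiv ℝ a z v)
    have h2 := abs_real_inner_le_norm (b z) (fderiv ℝ b z v)
    have h3 : |⟪a z, fderiv ℝ a z v⟫ + ⟪b z, fderiv ℝ b z v⟫| ≤
        ‖a z‖ * ‖fderiv ℝ a z v‖ + ‖b z‖ * ‖fderiv ℝ b z v‖ :=
      (abs_add_le _ _).trans (add_le_add h1 h2)
    have h4 := sq_le_sq' (by linarith [abs_nonneg (⟪a z, fderiv ℝ a z v⟫ +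
      ⟪b z, fderiv ℝ b z v⟫), norm_nonneg (a z)]) h3
    rw [sq_abs] at h4
    have h5 : (‖a z‖ * ‖fderiv ℝ a z v‖ + ‖b z‖ * ‖fderiv ℝ b z v‖) ^ 2 ≤
        pairSq a b z * (‖fderiv ℝ a z v‖ ^ 2 + ‖fderiv ℝ b z v‖ ^ 2) := by
      unfold pairSq
      nlinarith [sq_nonneg (‖a z‖ * ‖fderiv ℝ b z v‖ - ‖b z‖ * ‖fderiv ℝ a z v‖)]
    exact h4.trans (h5.trans (mul_le_mul_of_nonneg_left hv (pairSq_nonneg z)))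
  refine (norm_le_of_prod_basis _).trans ?_
  have h1 := key (1, 0) (by
    have h1 : 0 ≤ ‖pd2 a z‖ ^ 2 := by positivity
    have h2 : 0 ≤ ‖pd2 b z‖ ^ 2 := by positivity
    change ‖pd1 a z‖ ^ 2 + ‖pd1 b z‖ ^ 2 ≤ _
    unfold pairGradSq; linarith)
  have h2 := key (0, 1) (by
    have h1 : 0 ≤ ‖pd1 a z‖ ^ 2 := by positivity
    have h2 : 0 ≤ ‖pd1 b z‖ ^ 2 := by positivity
    change ‖pd2 a z‖ ^ 2 + ‖pd2 b z‖ ^ 2 ≤ _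
    unfold pairGradSq; linarith)
  linarith

lemma sq_lintegral_sqrt_le {s : Set (ℝ × ℝ)} {q : ℝ × ℝ → ℝ} (hq : Continuous q)
    (hq0 : ∀ z, 0 ≤ q z) :
    (∫⁻ z in s, ENNReal.ofReal (√(q z))) ^ (2 : ℝ) ≤
      (∫⁻ z in s, ENNReal.ofReal (q z)) * volume s := by
  have h := ENNReal.lintegral_mul_le_Lp_mul_Lq (volume.restrict s) Real.HolderConjugate.two_two
    (f := fun z => ENNReal.ofReal (√(q z))) (g := fun _ => 1)
    (by fun_prop) (by fun_prop)
  have e (z : ℝ × ℝ) : ENNReal.ofReal (√(q z)) ^ (2 : ℝ) = ENNReal.ofReal (q z) := by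
    rw [ENNReal.ofReal_rpow_of_nonneg (Real.sqrt_nonneg _) (by norm_num)]
    norm_num [Real.sq_sqrt (hq0 z)]
  simp only [Pi.mul_apply, mul_one, e, ENNReal.one_rpow, lintegral_const,
    Measure.restrict_apply_univ, one_mul] at h
  refine (ENNReal.rpow_le_rpow h (by norm_num)).trans ?_
  rw [ENNReal.mul_rpow_of_nonneg _ _ (by norm_num), ← ENNReal.rpow_mul, ← ENNReal.rpow_mul]
  norm_num

/-- One step of the level set iteration, from the Gagliardo–Nirenberg–Sobolev inequality. -/
lemma exists_volume_superlevel_le : ∃ C > (0 : ℝ), ∀ {n : ℕ}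
    {a b : ℝ × ℝ → EuclideanSpace ℝ (Fin n)}, ContDiff ℝ 2 a → ContDiff ℝ 2 b →
    HasCompactSupport a → HasCompactSupport b → ∀ l > 0,
    volume {z | 4 * l < pairSq a b z} ≤ ENNReal.ofReal (C / l) *
      ((∫⁻ z in {z | pairSq a b z ≤ 4 * l}, ENNReal.ofReal (pairGradSq a b z)) *
        volume {z | l < pairSq a b z}) := by
  obtain ⟨M, hM0, hM⟩ := exists_deriv_smoothTransition_bound
  set K := lintegralPowLePowLIntegralFDerivConst (volume : Measure (ℝ × ℝ)) 2 with hK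
  refine ⟨(K + 1) * (8 * M) ^ 2, by positivity, fun {n a b} ha hb hac hbc l hl => ?_⟩
  set T : ℝ → ℝ := fun x => Real.smoothTransition ((x / l - 1) / 3) with hT
  set u : ℝ × ℝ → ℝ := fun z => T (pairSq a b z) with hu
  have hTd (x : ℝ) : HasDerivAt T (deriv Real.smoothTransition ((x / l - 1) / 3) * (1 / l / 3)) x :=
    ((Real.smoothTransition.contDiff (n := 1)).differentiable (by norm_num) _).hasDerivAt.comp x
      ((((hasDerivAt_id x).div_const l).sub_const 1).div_const 3)
  have hr := contDiff_pairSq ha hb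
  have hu1 : ContDiff ℝ 1 u := by
    refine (Real.smoothTransition.contDiff (n := 1)).comp ?_
    exact (((hr.of_le (by norm_num)).div_const l).sub contDiff_const).div_const 3
  have huc : HasCompactSupport u := by
    refine .intro' (hac.isCompact.union hbc.isCompact)
      ((isClosed_tsupport a).union (isClosed_tsupport b)) fun z hz => ?_
    have hza := image_eq_zero_of_notMem_tsupport (fun h => hz (Or.inl h))
    have hzb := image_eq_zero_of_notMem_tsupport (fun h => hz (Or.inr h))
    refine Real.smoothTransition.zero_of_nonpos ?_
    simp [pairSq, hza, hzb]
    norm_num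
  have hgns := lintegral_pow_le_pow_lintegral_fderiv (volume : Measure (ℝ × ℝ)) hu1 huc (p := 2)
    (by simpa using Real.HolderConjugate.two_two)
  set S := {z | l < pairSq a b z ∧ pairSq a b z ≤ 4 * l} with hS
  have hSm : MeasurableSet S :=
    (measurableSet_lt measurable_const hr.continuous.measurable).inter
      (measurableSet_le hr.continuous.measurable measurable_const)
  have hbound (z : ℝ × ℝ) : ‖fderiv ℝ u z‖ₑ ≤
      S.indicator (fun z => ENNReal.ofReal (8 * M / √l) *
        ENNReal.ofReal (√(pairGradSq a b z))) z := by
    have hfd : HasFDerivAt u _ z :=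
      (hTd (pairSq a b z)).comp_hasFDerivAt z (hr.differentiable (by norm_num) z).hasFDerivAt
    by_cases hz : z ∈ S
    · rw [hfd.fderiv, indicator_of_mem hz, ← ENNReal.ofReal_mul (by positivity), ← ofReal_norm,
        norm_smul]
      refine ENNReal.ofReal_le_ofReal ?_
      have h1 := norm_fderiv_pairSq_le ha hb z
      have h2 : √(pairSq a b z) ≤ 2 * √l := by
        refine (Real.sqrt_le_sqrt hz.2).trans (le_of_eq ?_)
        rw [Real.sqrt_mul (by norm_num), show (4 : ℝ) = 2 ^ 2 by norm_num,
          Real.sqrt_sq (by norm_num)]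
      have h3 : ‖deriv Real.smoothTransition ((pairSq a b z / l - 1) / 3) * (1 / l / 3)‖
          ≤ M * (1 / l) := by
        rw [norm_mul]
        refine mul_le_mul (hM _) ?_ (norm_nonneg _) hM0.le
        rw [Real.norm_of_nonneg (by positivity)]
        exact div_le_self (by positivity) (by norm_num)
      calc _ ≤ M * (1 / l) * (4 * (2 * √l * √(pairGradSq a b z))) := by
            refine mul_le_mul h3 (h1.trans ?_) (norm_nonneg _) (by positivity)
            gcongr
        _ = 8 * M * (√l / l) * √(pairGradSq a b z) := by ring
        _ = _ := by rw [Real.sqrt_div_self]; ring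
    · have h0 : deriv Real.smoothTransition ((pairSq a b z / l - 1) / 3) = 0 := by
        apply deriv_smoothTransition_eq_zero
        by_contra! hcon
        refine hz ⟨?_, ?_⟩
        · have := hcon.1
          have h1 : 1 < pairSq a b z / l := by linarith
          rwa [one_lt_div hl] at h1
        · have h1 : pairSq a b z / l ≤ 4 := by linarith [hcon.2]
          rwa [div_le_iff₀ hl] at h1
      have h1 : fderiv ℝ u z = 0 := by
        rw [hfd.fderiv, h0, zero_mul]
        exact zero_smul ℝ _
      rw [h1, ← ofReal_norm, norm_zero, ENNReal.ofReal_zero]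
      exact bot_le
  have hl1 : volume {z | 4 * l < pairSq a b z} ≤ ∫⁻ z, ‖u z‖ₑ ^ (2 : ℝ) := by
    rw [← setLIntegral_one]
    refine (setLIntegral_mono' (measurableSet_lt measurable_const hr.continuous.measurable)
      fun z hz => ?_).trans (setLIntegral_le_lintegral _ _)
    have hz' : 4 * l < pairSq a b z := hz
    have : u z = 1 := by
      refine Real.smoothTransition.one_of_one_le ?_
      have : 4 ≤ pairSq a b z / l := (le_div_iff₀ hl).2 hz'.le
      linarith
    simp [this]
  have hl2 : (∫⁻ z, ‖fderiv ℝ u z‖ₑ) ^ (2 : ℝ) ≤ ENNReal.ofReal ((8 * M) ^ 2 / l) *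
      ((∫⁻ z in {z | pairSq a b z ≤ 4 * l}, ENNReal.ofReal (pairGradSq a b z)) *
        volume {z | l < pairSq a b z}) := by
    refine (ENNReal.rpow_le_rpow (lintegral_mono hbound) (by norm_num)).trans ?_
    have hq := continuous_pairGradSq ha hb
    rw [lintegral_indicator hSm, lintegral_const_mul _ (by fun_prop),
      ENNReal.mul_rpow_of_nonneg _ _ (by norm_num),
      ENNReal.ofReal_rpow_of_nonneg (by positivity) (by norm_num)]
    refine mul_le_mul' (le_of_eq ?_) ((sq_lintegral_sqrt_le hq pairGradSq_nonneg).trans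
      (mul_le_mul' (lintegral_mono_set fun z hz => hz.2) (measure_mono fun z hz => hz.1)))
    norm_num [div_pow, Real.sq_sqrt hl.le]
  refine hl1.trans (hgns.trans ((mul_le_mul_right hl2 _).trans ?_))
  rw [← mul_assoc]
  refine mul_le_mul_left ?_ _
  rw [← ENNReal.ofReal_coe_nnreal, ← ENNReal.ofReal_mul (by positivity)]
  refine ENNReal.ofReal_le_ofReal ?_
  rw [mul_div_assoc]
  gcongr
  linarith

end LevelSets

section Decay

variable {n : ℕ}

lemma volume_disk_one_lt_top : volume (disk 1) < ⊤ := by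
  refine (measure_mono (t := Metric.closedBall (0 : ℝ × ℝ) 1) fun z hz => ?_).trans_lt
    measure_closedBall_lt_top
  have hz' : z.1 ^ 2 + z.2 ^ 2 < 1 ^ 2 := hz
  rw [mem_closedBall_zero_iff, Prod.norm_def]
  refine max_le (abs_le_of_sq_le_sq ?_ zero_le_one) (abs_le_of_sq_le_sq ?_ zero_le_one)
  · linarith [sq_nonneg z.2]
  · linarith [sq_nonneg z.1]

lemma isOpen_disk (r : ℝ) : IsOpen (disk r) :=
  isOpen_lt (by fun_prop) continuous_const

lemma rpow_le_mul_sq_add {x s p : ℝ} (hx : 0 ≤ x) (hs : 0 < s) (hp0 : 0 < p) (hp2 : p < 2) :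
    x ^ p ≤ s ^ (p - 2) * x ^ 2 + s ^ p := by
  rcases le_total x s with h | h
  · have := Real.rpow_le_rpow hx h hp0.le
    have : 0 ≤ s ^ (p - 2) * x ^ 2 := by positivity
    linarith
  · have hx0 : 0 < x := hs.trans_le h
    have h1 : x ^ (p - 2) ≤ s ^ (p - 2) := Real.rpow_le_rpow_of_nonpos hs h (by linarith)
    have h2 : x ^ p = x ^ (p - 2) * x ^ 2 := by
      rw [← Real.rpow_natCast x 2, ← Real.rpow_add hx0]; norm_num
    have h3 : 0 ≤ s ^ p := by positivity
    rw [h2]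
    nlinarith [mul_le_mul_of_nonneg_right h1 (sq_nonneg x)]

/-- Splitting of an `L^p` integral at height `s`. -/
lemma setLIntegral_sqrt_rpow_le {q : ℝ × ℝ → ℝ} (hq : Continuous q) (hq0 : ∀ z, 0 ≤ q z)
    {p s : ℝ} (hp0 : 0 < p) (hp2 : p < 2) (hs : 0 < s) (B : Set (ℝ × ℝ)) :
    ∫⁻ z in B, ENNReal.ofReal (√(q z) ^ p) ≤
      ENNReal.ofReal (s ^ (p - 2)) * (∫⁻ z in B, ENNReal.ofReal (q z)) +
        ENNReal.ofReal (s ^ p) * volume B := by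
  calc _ ≤ ∫⁻ z in B, (ENNReal.ofReal (s ^ (p - 2)) * ENNReal.ofReal (q z)
        + ENNReal.ofReal (s ^ p)) := by
        refine lintegral_mono fun z => ?_
        rw [← ENNReal.ofReal_mul (by positivity), ← ENNReal.ofReal_add
          (mul_nonneg (by positivity) (hq0 z)) (by positivity)]
        refine ENNReal.ofReal_le_ofReal ?_
        have := rpow_le_mul_sq_add (Real.sqrt_nonneg (q z)) hs hp0 hp2
        rwa [Real.sq_sqrt (hq0 z)] at this
    _ = _ := by
        rw [lintegral_add_right _ measurable_const, lintegral_const_mul _ (by fun_prop),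
          setLIntegral_const]

/-- Geometric decay of the superlevel sets and the resulting `L^p` bound, for a pair of compactly
supported fields whose weighted `∂̄` energy is small relative to the level. -/
lemma exists_lintegral_pairGradSq_rpow_le {p : ℝ} (hp1 : 1 < p) (hp2 : p < 2) {B : ℝ}
    (hB : 0 < B) : ∃ ε > (0 : ℝ), ∃ C > (0 : ℝ), ∀ {n : ℕ}
    {a b : ℝ × ℝ → EuclideanSpace ℝ (Fin n)}, ContDiff ℝ 2 a → ContDiff ℝ 2 b →
    HasCompactSupport a → HasCompactSupport b → (∀ z ∉ disk 1, pairSq a b z = 0) →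
    (∀ l > 0, ∫⁻ z, ENNReal.ofReal (l * (l + pairSq a b z)⁻¹ * dbarSq a b z)
      ≤ ENNReal.ofReal (l * ε + B)) →
    ∫⁻ z in disk 1, ENNReal.ofReal (√(pairGradSq a b z) ^ p) ≤ ENNReal.ofReal C := by
  obtain ⟨C₁, hC₁, hsob⟩ := exists_volume_superlevel_le
  obtain ⟨S, hS1, hS⟩ : ∃ S : ℝ, 0 < S ∧ 4 * S ^ (p - 2) ≤ 1 / 2 := by
    refine ⟨(1 / 8 : ℝ) ^ (p - 2)⁻¹, by positivity, ?_⟩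
    rw [← Real.rpow_mul (by norm_num), inv_mul_cancel₀ (by linarith)]
    norm_num
  set θ : ℝ := 1 / (2 * S ^ p) with hθ
  have hθ0 : 0 < θ := by positivity
  have hSθ : S ^ p * θ ≤ 1 / 2 := by
    rw [hθ]; field_simp; rfl
  set ε : ℝ := θ / (32 * C₁) with hε
  set Λ : ℝ := 8 * C₁ * B / θ with hΛ
  have hε0 : 0 < ε := by positivity
  have hΛ0 : 0 < Λ := by positivity
  set V : ℝ := (volume (disk 1)).toReal with hV
  set H : ℝ := 4 * (4 * Λ * ε + B) with hH
  have hV0 : 0 ≤ V := ENNReal.toReal_nonneg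
  have hH0 : 0 < H := by positivity
  refine ⟨ε, hε0, 3 * (H + V), by positivity, fun {n a b} ha hb hac hbc hsupp hE => ?_⟩
  have hr := (contDiff_pairSq ha hb).continuous
  have hq := continuous_pairGradSq ha hb
  have hJ (l : ℝ) (hl : 0 < l) : ∫⁻ z in {z | pairSq a b z ≤ l},
      ENNReal.ofReal (pairGradSq a b z) ≤ ENNReal.ofReal (4 * (l * ε + B)) := by
    refine (lintegral_pairGradSq_sublevel_le ha hb hac hbc hl).trans ?_
    rw [ENNReal.ofReal_mul (by norm_num)]
    refine (mul_le_mul_right (hE l hl) _).trans (le_of_eq ?_)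
    norm_num
  set lev : ℕ → ℝ := fun j => 4 ^ j * Λ with hlev
  have hlev0 (j : ℕ) : 0 < lev j := by positivity
  have hlevΛ (j : ℕ) : Λ ≤ lev j := le_mul_of_one_le_left hΛ0.le (one_le_pow₀ (by norm_num))
  have hlevs (j : ℕ) : lev (j + 1) = 4 * lev j := by simp only [hlev]; ring
  have hdecay (j : ℕ) : volume {z | lev j < pairSq a b z} ≤ ENNReal.ofReal (θ ^ j * V) := by
    induction j with
    | zero =>
      rw [pow_zero, one_mul, hV, ENNReal.ofReal_toReal volume_disk_one_lt_top.ne]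
      refine measure_mono fun z hz => ?_
      by_contra hcon
      have hz' : lev 0 < pairSq a b z := hz
      rw [hsupp z hcon] at hz'
      exact (hlev0 0).not_gt hz'
    | succ j ih =>
      have h1 := hsob ha hb hac hbc (lev j) (hlev0 j)
      rw [hlevs]
      refine h1.trans ((mul_le_mul_right (mul_le_mul' (hJ _ (by have := hlev0 j; positivity)) ih)
        _).trans ?_)
      have := hlev0 j
      rw [← ENNReal.ofReal_mul (by positivity), ← ENNReal.ofReal_mul (by positivity)]
      refine ENNReal.ofReal_le_ofReal ?_
      have h2 : C₁ / lev j * (4 * (4 * lev j * ε + B)) ≤ θ := by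
        have e1 : C₁ / lev j * (4 * (4 * lev j * ε + B)) = 16 * C₁ * ε + 4 * C₁ * B / lev j := by
          field_simp; ring
        have e2 : 16 * C₁ * ε = θ / 2 := by rw [hε]; field_simp; ring
        have e3 : 4 * C₁ * B / lev j ≤ 4 * C₁ * B / Λ := by gcongr; exact hlevΛ j
        have e4 : 4 * C₁ * B / Λ = θ / 2 := by rw [hΛ]; field_simp; ring
        linarith
      calc _ = C₁ / lev j * (4 * (4 * lev j * ε + B)) * (θ ^ j * V) := by ring
        _ ≤ θ * (θ ^ j * V) := by gcongr
        _ = _ := by ring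
  set P : ℕ → Set (ℝ × ℝ) := fun j => {z | lev j < pairSq a b z ∧ pairSq a b z ≤ lev (j + 1)}
  have hcover : disk 1 ⊆ (disk 1 ∩ {z | pairSq a b z ≤ Λ}) ∪ ⋃ j, P j := by
    intro z hz
    rcases le_or_gt (pairSq a b z) Λ with h | h
    · exact Or.inl ⟨hz, h⟩
    · right
      have hex : ∃ j, pairSq a b z ≤ lev j := by
        obtain ⟨j, hj⟩ := pow_unbounded_of_one_lt (pairSq a b z / Λ) (by norm_num : (1 : ℝ) < 4)
        exact ⟨j, ((div_lt_iff₀ hΛ0).1 hj).le⟩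
      classical
      have hspec := Nat.find_spec hex
      have hne : Nat.find hex ≠ 0 := by
        intro h0
        rw [h0] at hspec
        simp only [hlev, pow_zero, one_mul] at hspec
        linarith
      obtain ⟨j, hj⟩ := Nat.exists_eq_succ_of_ne_zero hne
      rw [hj] at hspec
      refine mem_iUnion.2 ⟨j, not_le.1 (Nat.find_min hex (by omega)), hspec⟩
  have hbase : ∫⁻ z in disk 1 ∩ {z | pairSq a b z ≤ Λ}, ENNReal.ofReal (√(pairGradSq a b z) ^ p)
      ≤ ENNReal.ofReal (H + V) := by
    refine (setLIntegral_sqrt_rpow_le hq pairGradSq_nonneg (by linarith) hp2 one_pos _).trans ?_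
    rw [Real.one_rpow, Real.one_rpow, ENNReal.ofReal_one, one_mul, one_mul,
      ENNReal.ofReal_add hH0.le hV0]
    refine add_le_add ((lintegral_mono_set inter_subset_right).trans ((hJ Λ hΛ0).trans
      (ENNReal.ofReal_le_ofReal ?_))) ?_
    · have : 0 ≤ Λ * ε := by positivity
      rw [hH]; linarith
    · rw [hV, ENNReal.ofReal_toReal volume_disk_one_lt_top.ne]
      exact measure_mono inter_subset_left
  have hpiece (j : ℕ) : ∫⁻ z in P j, ENNReal.ofReal (√(pairGradSq a b z) ^ p)
      ≤ ENNReal.ofReal ((H + V) * (1 / 2) ^ j) := by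
    refine (setLIntegral_sqrt_rpow_le hq pairGradSq_nonneg (by linarith) hp2
      (pow_pos hS1 j) _).trans ?_
    have e1 : (S ^ j) ^ (p - 2) = (S ^ (p - 2)) ^ j := by
      rw [← Real.rpow_natCast, ← Real.rpow_natCast, ← Real.rpow_mul hS1.le, ← Real.rpow_mul hS1.le,
        mul_comm]
    have e2 : (S ^ j) ^ p = (S ^ p) ^ j := by
      rw [← Real.rpow_natCast, ← Real.rpow_natCast, ← Real.rpow_mul hS1.le, ← Real.rpow_mul hS1.le,
        mul_comm]
    have h1 : ∫⁻ z in P j, ENNReal.ofReal (pairGradSq a b z) ≤ ENNReal.ofReal (4 ^ j * H) := by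
      refine (lintegral_mono_set fun z hz => hz.2).trans ((hJ _ (hlev0 (j + 1))).trans
        (ENNReal.ofReal_le_ofReal ?_))
      have h4 : (1 : ℝ) ≤ 4 ^ j := one_le_pow₀ (by norm_num)
      rw [hlevs, hH]
      simp only [hlev]
      nlinarith
    have h2 : volume (P j) ≤ ENNReal.ofReal (θ ^ j * V) :=
      (measure_mono fun z hz => hz.1).trans (hdecay j)
    rw [e1, e2]
    refine (add_le_add (mul_le_mul_right h1 _) (mul_le_mul_right h2 _)).trans ?_
    rw [← ENNReal.ofReal_mul (by positivity), ← ENNReal.ofReal_mul (by positivity),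
      ← ENNReal.ofReal_add (by positivity) (by positivity)]
    refine ENNReal.ofReal_le_ofReal ?_
    have h3 : (4 * S ^ (p - 2)) ^ j ≤ (1 / 2 : ℝ) ^ j := pow_le_pow_left₀ (by positivity) hS j
    have h4 : (S ^ p * θ) ^ j ≤ (1 / 2 : ℝ) ^ j := pow_le_pow_left₀ (by positivity) hSθ j
    rw [mul_pow] at h3 h4
    calc _ = 4 ^ j * (S ^ (p - 2)) ^ j * H + (S ^ p) ^ j * θ ^ j * V := by ring
      _ ≤ (1 / 2) ^ j * H + (1 / 2) ^ j * V := by gcongr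
      _ = _ := by ring
  calc _ ≤ ∫⁻ z in (disk 1 ∩ {z | pairSq a b z ≤ Λ}) ∪ ⋃ j, P j,
        ENNReal.ofReal (√(pairGradSq a b z) ^ p) := lintegral_mono_set hcover
    _ ≤ ENNReal.ofReal (H + V) + ∑' j, ENNReal.ofReal ((H + V) * (1 / 2) ^ j) :=
        (lintegral_union_le _ _ _).trans (add_le_add hbase
          ((lintegral_iUnion_le _ _).trans (ENNReal.tsum_le_tsum hpiece)))
    _ = ENNReal.ofReal (3 * (H + V)) := by
        rw [← ENNReal.ofReal_tsum_of_nonneg (fun j => by positivity)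
          (summable_geometric_two.mul_left _), tsum_mul_left, tsum_geometric_two,
          ← ENNReal.ofReal_add (by positivity) (by positivity)]
        ring_nf

end Decay

section Cutoff

variable {n : ℕ} {f : ℝ × ℝ → EuclideanSpace ℝ (Fin n)} {U : Set (ℝ × ℝ)} {ζ : ℝ × ℝ → ℝ}

/-- A cutoff function for the pair of concentric disks of radii `1/2` and `1`. -/
lemma exists_disk_cutoff : ∃ η : ℝ × ℝ → ℝ, ContDiff ℝ (⊤ : ℕ∞) η ∧ HasCompactSupport η ∧
    tsupport η ⊆ disk 1 ∧ (∀ z ∈ disk (1 / 2), η =ᶠ[nhds z] 1) ∧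
    ∃ M > (0 : ℝ), ∀ z, ‖fderiv ℝ η z‖ ≤ M := by
  let η : ContDiffBump (0 : ℝ × ℝ) := ⟨1 / 2, 7 / 10, by norm_num, by norm_num⟩
  have hη : ContDiff ℝ (⊤ : ℕ∞) η := η.contDiff
  obtain ⟨M, hM⟩ := (η.hasCompactSupport.fderiv ℝ).exists_bound_of_continuous
    (hη.continuous_fderiv (by simp))
  refine ⟨η, hη, η.hasCompactSupport, fun z hz => ?_, fun z hz => ?_, max M 1, by positivity,
    fun z => (hM z).trans (le_max_left _ _)⟩
  · rw [η.tsupport_eq, mem_closedBall_zero_iff] at hz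
    have hz' : ‖z‖ ≤ 7 / 10 := hz
    have h1 : |z.1| ≤ 7 / 10 := (norm_fst_le z).trans hz'
    have h2 : |z.2| ≤ 7 / 10 := (norm_snd_le z).trans hz'
    have h1' := sq_le_sq' (by linarith [abs_nonneg z.1]) h1
    have h2' := sq_le_sq' (by linarith [abs_nonneg z.2]) h2
    rw [sq_abs] at h1' h2'
    change z.1 ^ 2 + z.2 ^ 2 < 1 ^ 2
    linarith
  · refine η.eventuallyEq_one_of_mem_ball ?_
    have hz' : z.1 ^ 2 + z.2 ^ 2 < (1 / 2) ^ 2 := hz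
    rw [mem_ball_zero_iff, Prod.norm_def]
    change max ‖z.1‖ ‖z.2‖ < 1 / 2
    refine max_lt ?_ ?_
    · exact abs_lt_of_sq_lt_sq (by linarith [sq_nonneg z.2]) (by norm_num)
    · exact abs_lt_of_sq_lt_sq (by linarith [sq_nonneg z.1]) (by norm_num)

lemma contDiff_cutoff_smul {F : ℝ × ℝ → EuclideanSpace ℝ (Fin n)} (hU : IsOpen U)
    (hF : ContDiffOn ℝ 2 F U) (hζ : ContDiff ℝ 2 ζ) (hsupp : tsupport ζ ⊆ U) :
    ContDiff ℝ 2 (fun z => ζ z • F z) := by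
  rw [contDiff_iff_contDiffAt]
  intro z
  by_cases hz : z ∈ tsupport ζ
  · exact hζ.contDiffAt.smul (hF.contDiffAt (hU.mem_nhds (hsupp hz)))
  · have h := notMem_tsupport_iff_eventuallyEq.1 hz
    refine (contDiffAt_const (c := (0 : EuclideanSpace ℝ (Fin n)))).congr_of_eventuallyEq ?_
    filter_upwards [h] with y hy
    simp [hy]

lemma two_add_one_le_top : (2 : WithTop ℕ∞) + 1 ≤ ((⊤ : ℕ∞) : WithTop ℕ∞) := by
  rw [show (2 : WithTop ℕ∞) + 1 = ((3 : ℕ∞) : WithTop ℕ∞) by norm_num]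
  exact WithTop.coe_le_coe.2 le_top

lemma contDiffOn_pd1 (hU : IsOpen U) (hf : ContDiffOn ℝ (⊤ : ℕ∞) f U) :
    ContDiffOn ℝ 2 (pd1 f) U :=
  (hf.fderiv_of_isOpen (m := 2) hU two_add_one_le_top).clm_apply contDiffOn_const

lemma contDiffOn_pd2 (hU : IsOpen U) (hf : ContDiffOn ℝ (⊤ : ℕ∞) f U) :
    ContDiffOn ℝ 2 (pd2 f) U :=
  (hf.fderiv_of_isOpen (m := 2) hU two_add_one_le_top).clm_apply contDiffOn_const

lemma fderiv_fderiv_apply (hU : IsOpen U) (hf : ContDiffOn ℝ (⊤ : ℕ∞) f U) {z : ℝ × ℝ}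
    (hz : z ∈ U) (v w : ℝ × ℝ) :
    fderiv ℝ (fun y => fderiv ℝ f y v) z w = fderiv ℝ (fderiv ℝ f) z w v := by
  have hd : DifferentiableAt ℝ (fderiv ℝ f) z :=
    ((hf.fderiv_of_isOpen (m := 2) hU two_add_one_le_top).contDiffAt
      (hU.mem_nhds hz)).differentiableAt (by norm_num)
  rw [fderiv_clm_apply hd (by fun_prop)]; simp

lemma pd2_pd1_eq (hU : IsOpen U) (hf : ContDiffOn ℝ (⊤ : ℕ∞) f U) {z : ℝ × ℝ} (hz : z ∈ U) :
    pd2 (pd1 f) z = pd1 (pd2 f) z := by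
  have hs : IsSymmSndFDerivAt ℝ f z :=
    (hf.contDiffAt (hU.mem_nhds hz)).isSymmSndFDerivAt
      (by simpa using le_self_add.trans two_add_one_le_top)
  change fderiv ℝ (fun y => fderiv ℝ f y (1, 0)) z _ = fderiv ℝ (fun y => fderiv ℝ f y (0, 1)) z _
  rw [fderiv_fderiv_apply hU hf hz, fderiv_fderiv_apply hU hf hz]
  exact hs _ _

lemma norm_fderiv_fderiv_le (hU : IsOpen U) (hf : ContDiffOn ℝ (⊤ : ℕ∞) f U) {z : ℝ × ℝ}
    (hz : z ∈ U) :
    ‖fderiv ℝ (fderiv ℝ f) z‖ ≤ 2 * √(pairGradSq (pd1 f) (pd2 f) z) := by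
  have e (v w : ℝ × ℝ) := fderiv_fderiv_apply hU hf hz v w
  have h0 := norm_le_of_prod_basis (fderiv ℝ (fderiv ℝ f) z)
  have h1 := norm_le_of_prod_basis (fderiv ℝ (fderiv ℝ f) z (1, 0))
  have h2 := norm_le_of_prod_basis (fderiv ℝ (fderiv ℝ f) z (0, 1))
  rw [← e, ← e] at h1 h2
  change _ ≤ ‖pd1 (pd1 f) z‖ + ‖pd1 (pd2 f) z‖ at h1
  change _ ≤ ‖pd2 (pd1 f) z‖ + ‖pd2 (pd2 f) z‖ at h2
  have h3 : (‖pd1 (pd1 f) z‖ + ‖pd2 (pd1 f) z‖ + ‖pd1 (pd2 f) z‖ + ‖pd2 (pd2 f) z‖) / 2 ≤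
      √(pairGradSq (pd1 f) (pd2 f) z) := by
    refine Real.le_sqrt_of_sq_le ?_
    unfold pairGradSq
    set x := ‖pd1 (pd1 f) z‖
    set y := ‖pd2 (pd1 f) z‖
    set s := ‖pd1 (pd2 f) z‖
    set t := ‖pd2 (pd2 f) z‖
    nlinarith [sq_nonneg (x - y), sq_nonneg (x - s), sq_nonneg (x - t), sq_nonneg (y - s),
      sq_nonneg (y - t), sq_nonneg (s - t)]
  linarith

lemma gradSq_nonneg (z : ℝ × ℝ) : 0 ≤ gradSq f z := by unfold gradSq; positivity

lemma fderiv_eq_zero_of_gradSq_eq_zero {z : ℝ × ℝ} (h : gradSq f z = 0) : fderiv ℝ f z = 0 := by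
  have h1 : ‖pd1 f z‖ ^ 2 = 0 := by
    unfold gradSq at h; nlinarith [sq_nonneg ‖pd1 f z‖, sq_nonneg ‖pd2 f z‖]
  have h2 : ‖pd2 f z‖ ^ 2 = 0 := by
    unfold gradSq at h; nlinarith [sq_nonneg ‖pd1 f z‖, sq_nonneg ‖pd2 f z‖]
  have h3 := norm_le_of_prod_basis (fderiv ℝ f z)
  change _ ≤ ‖pd1 f z‖ + ‖pd2 f z‖ at h3
  rw [pow_eq_zero_iff two_ne_zero] at h1 h2
  rw [h1, h2, add_zero] at h3
  exact norm_le_zero_iff.1 h3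

lemma pairSq_cutoff (z : ℝ × ℝ) :
    pairSq (fun z => ζ z • pd1 f z) (fun z => ζ z • pd2 f z) z = ζ z ^ 2 * gradSq f z := by
  simp only [pairSq, gradSq, norm_smul, mul_pow, Real.norm_eq_abs, sq_abs]; ring

lemma norm_add_sq_le_two_mul {E : Type*} [NormedAddCommGroup E] [InnerProductSpace ℝ E]
    (x y : E) : ‖x + y‖ ^ 2 ≤ 2 * ‖x‖ ^ 2 + 2 * ‖y‖ ^ 2 := by
  have h := norm_sub_sq_real x y
  have h' := norm_add_sq_real x y
  nlinarith [sq_nonneg ‖x - y‖]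

lemma fderiv_cutoff_smul {F : ℝ × ℝ → EuclideanSpace ℝ (Fin n)} {z : ℝ × ℝ}
    (hF : DifferentiableAt ℝ F z) (hζ : DifferentiableAt ℝ ζ z) (v : ℝ × ℝ) :
    fderiv ℝ (fun z => ζ z • F z) z v = ζ z • fderiv ℝ F z v + fderiv ℝ ζ z v • F z := by
  rw [fderiv_fun_smul hζ hF]; simp

lemma dbarSq_cutoff_le {M : ℝ} (hU : IsOpen U) (hf : ContDiffOn ℝ (⊤ : ℕ∞) f U)
    (hζ : ContDiff ℝ 2 ζ) (hM : ∀ z, ‖fderiv ℝ ζ z‖ ≤ M) {z : ℝ × ℝ} (hz : z ∈ U) :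
    dbarSq (fun z => ζ z • pd1 f z) (fun z => ζ z • pd2 f z) z ≤
      2 * (ζ z ^ 2 * ‖lap f z‖ ^ 2) + 8 * M ^ 2 * gradSq f z := by
  have hd := hζ.differentiable (by norm_num) z
  have h1 := ((contDiffOn_pd1 hU hf).contDiffAt (hU.mem_nhds hz)).differentiableAt (by norm_num)
  have h2 := ((contDiffOn_pd2 hU hf).contDiffAt (hU.mem_nhds hz)).differentiableAt (by norm_num)
  have hx : |fderiv ℝ ζ z (1, 0)| ≤ M := by
    simpa using (fderiv ℝ ζ z).le_of_opNorm_le (hM z) (1, 0)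
  have hy : |fderiv ℝ ζ z (0, 1)| ≤ M := by
    simpa using (fderiv ℝ ζ z).le_of_opNorm_le (hM z) (0, 1)
  have hx2 := sq_le_sq' (by linarith [abs_nonneg (fderiv ℝ ζ z (1, 0))]) hx
  have hy2 := sq_le_sq' (by linarith [abs_nonneg (fderiv ℝ ζ z (0, 1))]) hy
  set ζx := fderiv ℝ ζ z (1, 0)
  set ζy := fderiv ℝ ζ z (0, 1)
  rw [sq_abs] at hx2 hy2
  have e1 : pd1 (fun z => ζ z • pd1 f z) z + pd2 (fun z => ζ z • pd2 f z) z =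
      ζ z • lap f z + (ζx • pd1 f z + ζy • pd2 f z) := by
    have d1 : pd1 (fun z => ζ z • pd1 f z) z = ζ z • pd1 (pd1 f) z + ζx • pd1 f z :=
      fderiv_cutoff_smul h1 hd _
    have d2 : pd2 (fun z => ζ z • pd2 f z) z = ζ z • pd2 (pd2 f) z + ζy • pd2 f z :=
      fderiv_cutoff_smul h2 hd _
    rw [d1, d2, lap]
    module
  have e2 : pd2 (fun z => ζ z • pd1 f z) z - pd1 (fun z => ζ z • pd2 f z) z =
      ζy • pd1 f z + (-ζx) • pd2 f z := by
    have d1 : pd2 (fun z => ζ z • pd1 f z) z = ζ z • pd2 (pd1 f) z + ζy • pd1 f z :=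
      fderiv_cutoff_smul h1 hd _
    have d2 : pd1 (fun z => ζ z • pd2 f z) z = ζ z • pd1 (pd2 f) z + ζx • pd2 f z :=
      fderiv_cutoff_smul h2 hd _
    rw [d1, d2, pd2_pd1_eq hU hf hz]
    module
  have b1 := norm_add_sq_le_two_mul (ζ z • lap f z) (ζx • pd1 f z + ζy • pd2 f z)
  have b2 := norm_add_sq_le_two_mul (ζx • pd1 f z) (ζy • pd2 f z)
  have b3 := norm_add_sq_le_two_mul (ζy • pd1 f z) ((-ζx) • pd2 f z)
  simp only [norm_smul, mul_pow, Real.norm_eq_abs, sq_abs, neg_sq] at b1 b2 b3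
  have c1 := mul_le_mul_of_nonneg_right hx2 (sq_nonneg ‖pd1 f z‖)
  have c2 := mul_le_mul_of_nonneg_right hy2 (sq_nonneg ‖pd2 f z‖)
  have c3 := mul_le_mul_of_nonneg_right hy2 (sq_nonneg ‖pd1 f z‖)
  have c4 := mul_le_mul_of_nonneg_right hx2 (sq_nonneg ‖pd2 f z‖)
  have c5 : 0 ≤ M ^ 2 * ‖pd1 f z‖ ^ 2 := by positivity
  have c6 : 0 ≤ M ^ 2 * ‖pd2 f z‖ ^ 2 := by positivity
  rw [dbarSq, e1, e2, gradSq]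
  linarith

lemma setLIntegral_disk_le_willmore :
    ∫⁻ z in disk 1, ENNReal.ofReal (‖lap f z‖ ^ 2 / gradSq f z) ≤ willmore f (disk 1) := by
  rw [willmore, inter_comm, ← Measure.restrict_restrict' (isOpen_disk 1).measurableSet]
  refine le_trans (lintegral_mono fun z => ?_) (lintegral_indicator_le _ _)
  by_cases hz : gradSq f z = 0
  · simp [hz]
  · rw [indicator_of_mem (show z ∈ {w | gradSq f w ≠ 0} from hz)]

lemma lintegral_weight_dbarSq_cutoff_le {M : ℝ} (hU : IsOpen U)
    (hf : ContDiffOn ℝ (⊤ : ℕ∞) f U) (hDU : disk 1 ⊆ U)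
    (hlap : ∀ z ∈ disk 1, fderiv ℝ f z = 0 → lap f z = 0)
    (hζ : ContDiff ℝ 2 ζ) (hsupp : tsupport ζ ⊆ disk 1) (hM : ∀ z, ‖fderiv ℝ ζ z‖ ≤ M)
    {l : ℝ} (hl : 0 < l) :
    ∫⁻ z, ENNReal.ofReal
        (l * (l + pairSq (fun z => ζ z • pd1 f z) (fun z => ζ z • pd2 f z) z)⁻¹ *
          dbarSq (fun z => ζ z • pd1 f z) (fun z => ζ z • pd2 f z) z) ≤
      ENNReal.ofReal (2 * l) * willmore f (disk 1) +
        ENNReal.ofReal (8 * M ^ 2) * ∫⁻ z in disk 1, ENNReal.ofReal (gradSq f z) := by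
  have hDm := (isOpen_disk 1).measurableSet
  have hzero (z : ℝ × ℝ) (hz : z ∉ disk 1) :
      dbarSq (fun z => ζ z • pd1 f z) (fun z => ζ z • pd2 f z) z = 0 := by
    refine dbarSq_eq_zero fun h => hz (hsupp ?_)
    exact h.elim (fun h => tsupport_smul_subset_left ζ _ h)
      (fun h => tsupport_smul_subset_left ζ _ h)
  have hpt (z : ℝ × ℝ) : ENNReal.ofReal
        (l * (l + pairSq (fun z => ζ z • pd1 f z) (fun z => ζ z • pd2 f z) z)⁻¹ *
          dbarSq (fun z => ζ z • pd1 f z) (fun z => ζ z • pd2 f z) z) ≤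
      (disk 1).indicator (fun z => ENNReal.ofReal (2 * l) *
        ENNReal.ofReal (‖lap f z‖ ^ 2 / gradSq f z) +
        ENNReal.ofReal (8 * M ^ 2) * ENNReal.ofReal (gradSq f z)) z := by
    by_cases hz : z ∈ disk 1
    · have hg := gradSq_nonneg (f := f) z
      have hq : 0 ≤ ‖lap f z‖ ^ 2 / gradSq f z := by positivity
      rw [indicator_of_mem hz, ← ENNReal.ofReal_mul (by positivity),
        ← ENNReal.ofReal_mul (by positivity), ← ENNReal.ofReal_add (by positivity) (by positivity)]
      refine ENNReal.ofReal_le_ofReal ?_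
      have hb := dbarSq_cutoff_le hU hf hζ hM (hDU hz)
      rw [pairSq_cutoff]
      have hlg : ‖lap f z‖ ^ 2 = gradSq f z * (‖lap f z‖ ^ 2 / gradSq f z) := by
        by_cases h0 : gradSq f z = 0
        · rw [hlap z hz (fderiv_eq_zero_of_gradSq_eq_zero h0)]; simp
        · field_simp
      have hr : 0 ≤ ζ z ^ 2 * gradSq f z := by positivity
      rw [hlg] at hb
      set W := ‖lap f z‖ ^ 2 / gradSq f z
      set r := ζ z ^ 2 * gradSq f z with hrdef
      have hs : 0 < l + r := by positivity
      have hw1 : l * (l + r)⁻¹ ≤ 1 := by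
        rw [← div_eq_mul_inv, div_le_one hs]; linarith
      have hw2 : r * (l + r)⁻¹ ≤ 1 := by
        rw [← div_eq_mul_inv, div_le_one hs]; linarith
      have hG : 0 ≤ 8 * M ^ 2 * gradSq f z := by positivity
      calc l * (l + r)⁻¹ * dbarSq _ _ z
          ≤ l * (l + r)⁻¹ * (2 * (ζ z ^ 2 * (gradSq f z * W)) + 8 * M ^ 2 * gradSq f z) := by gcongr
        _ = 2 * l * W * (r * (l + r)⁻¹) + l * (l + r)⁻¹ * (8 * M ^ 2 * gradSq f z) := by
          rw [hrdef]; ring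
        _ ≤ 2 * l * W * 1 + 1 * (8 * M ^ 2 * gradSq f z) := by gcongr
        _ = _ := by ring
    · rw [hzero z hz]; simp
  have hgm : AEMeasurable (fun z => ENNReal.ofReal (8 * M ^ 2) * ENNReal.ofReal (gradSq f z))
      (volume.restrict (disk 1)) := by
    have h1 := (contDiffOn_pd1 hU hf).continuousOn.mono hDU
    have h2 := (contDiffOn_pd2 hU hf).continuousOn.mono hDU
    have h3 : ContinuousOn (gradSq f) (disk 1) := (h1.norm.pow 2).add (h2.norm.pow 2)
    exact (h3.aemeasurable hDm).ennreal_ofReal.const_mul _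
  calc _ ≤ _ := lintegral_mono hpt
    _ = _ := lintegral_indicator hDm _
    _ = _ := lintegral_add_right' _ hgm
    _ ≤ _ := by
      rw [lintegral_const_mul' _ _ ENNReal.ofReal_ne_top,
        lintegral_const_mul' _ _ ENNReal.ofReal_ne_top]
      gcongr
      exact setLIntegral_disk_le_willmore

lemma pairGradSq_cutoff_of_eventuallyEq {c : ℝ} {z : ℝ × ℝ} (h : ζ =ᶠ[nhds z] fun _ => c)
    (hU : IsOpen U) (hf : ContDiffOn ℝ (⊤ : ℕ∞) f U) (hz : z ∈ U) :
    pairGradSq (fun z => ζ z • pd1 f z) (fun z => ζ z • pd2 f z) z =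
      c ^ 2 * pairGradSq (pd1 f) (pd2 f) z := by
  have h1 := ((contDiffOn_pd1 hU hf).contDiffAt (hU.mem_nhds hz)).differentiableAt (by norm_num)
  have h2 := ((contDiffOn_pd2 hU hf).contDiffAt (hU.mem_nhds hz)).differentiableAt (by norm_num)
  have key {F : ℝ × ℝ → EuclideanSpace ℝ (Fin n)} (hF : DifferentiableAt ℝ F z) :
      fderiv ℝ (fun z => ζ z • F z) z = c • fderiv ℝ F z := by
    have h3 : (fun z => ζ z • F z) =ᶠ[nhds z] fun z => c • F z := by
      filter_upwards [h] with y hy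
      rw [hy]
    rw [h3.fderiv_eq, fderiv_fun_const_smul hF]
  have d1 : pd1 (fun z => ζ z • pd1 f z) z = c • pd1 (pd1 f) z := by rw [pd1, key h1]; rfl
  have d2 : pd2 (fun z => ζ z • pd1 f z) z = c • pd2 (pd1 f) z := by rw [pd2, key h1]; rfl
  have d3 : pd1 (fun z => ζ z • pd2 f z) z = c • pd1 (pd2 f) z := by rw [pd1, key h2]; rfl
  have d4 : pd2 (fun z => ζ z • pd2 f z) z = c • pd2 (pd2 f) z := by rw [pd2, key h2]; rfl
  rw [pairGradSq, pairGradSq, d1, d2, d3, d4]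
  simp only [norm_smul, mul_pow, Real.norm_eq_abs, sq_abs]
  ring

end Cutoff

/-- `ε`-regularity at a fixed scale `K` for the Dirichlet energy. -/
lemma exists_epsilon_regularity_of_energy_le {p : ℝ} (hp1 : 1 < p) (hp2 : p < 2) :
    ∃ ε₀ > (0:ℝ), ∃ C > (0:ℝ), ∀ {n : ℕ} (f : ℝ × ℝ → EuclideanSpace ℝ (Fin n)),
        (∃ U : Set (ℝ × ℝ), IsOpen U ∧ closedDisk 1 ⊆ U ∧ ContDiffOn ℝ (⊤ : ℕ∞) f U) →
        (∀ z ∈ disk 1, fderiv ℝ f z = 0 → lap f z = 0) →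
        willmore f (disk 1) < ENNReal.ofReal (ε₀ ^ 2) →
        ∀ K > (0 : ℝ), ∫⁻ z in disk 1, ENNReal.ofReal (gradSq f z) ≤ ENNReal.ofReal (K ^ 2) →
        (∫⁻ z in disk (1/2),
            ENNReal.ofReal (Real.sqrt (gradSq f z) ^ p + ‖fderiv ℝ (fderiv ℝ f) z‖ ^ p))
          ^ (1 / p) ≤ ENNReal.ofReal (C * K) := by
  obtain ⟨η, hη, hηc, hηs, hη1, M, hM0, hM⟩ := exists_disk_cutoff
  obtain ⟨ε, hε, C, hC, hmain⟩ := exists_lintegral_pairGradSq_rpow_le hp1 hp2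
    (B := 8 * M ^ 2) (by positivity)
  set V : ℝ := (volume (disk 1)).toReal with hV
  have hV0 : 0 ≤ V := ENNReal.toReal_nonneg
  have hp0 : 0 < p := by linarith
  refine ⟨√(ε / 2), by positivity, (1 + (V + 2 ^ p * C)) ^ (1 / p), by positivity, ?_⟩
  rintro n f ⟨U, hU, hDU, hf⟩ hlap hW K hK hE
  rw [Real.sq_sqrt (by positivity)] at hW
  have hDU' : disk 1 ⊆ U := fun z hz =>
    hDU (show z.1 ^ 2 + z.2 ^ 2 ≤ 1 ^ 2 from le_of_lt hz)
  have hhalf : disk (1 / 2) ⊆ disk 1 := by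
    intro z hz
    have hz' : z.1 ^ 2 + z.2 ^ 2 < (1 / 2) ^ 2 := hz
    change z.1 ^ 2 + z.2 ^ 2 < 1 ^ 2
    linarith
  set ζ : ℝ × ℝ → ℝ := fun z => K⁻¹ * η z with hζdef
  have hζ : ContDiff ℝ 2 ζ := contDiff_const.mul (hη.of_le (le_self_add.trans two_add_one_le_top))
  have hζsub : tsupport ζ ⊆ tsupport η := closure_mono fun z hz h0 => hz (by simp [hζdef, h0])
  have hζs : tsupport ζ ⊆ disk 1 := hζsub.trans hηs
  have hζc : HasCompactSupport ζ := hηc.mono' (subset_closure.trans hζsub)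
  have hζM (z : ℝ × ℝ) : ‖fderiv ℝ ζ z‖ ≤ K⁻¹ * M := by
    rw [hζdef, fderiv_const_mul (hη.differentiable (by simp) z), norm_smul,
      Real.norm_of_nonneg (by positivity)]
    gcongr
    exact hM z
  set a : ℝ × ℝ → EuclideanSpace ℝ (Fin n) := fun z => ζ z • pd1 f z with ha_def
  set b : ℝ × ℝ → EuclideanSpace ℝ (Fin n) := fun z => ζ z • pd2 f z with hb_def
  have ha : ContDiff ℝ 2 a :=
    contDiff_cutoff_smul hU (contDiffOn_pd1 hU hf) hζ (hζs.trans hDU')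
  have hb : ContDiff ℝ 2 b :=
    contDiff_cutoff_smul hU (contDiffOn_pd2 hU hf) hζ (hζs.trans hDU')
  have hac : HasCompactSupport a := hζc.smul_right
  have hbc : HasCompactSupport b := hζc.smul_right
  have hout (z : ℝ × ℝ) (hz : z ∉ disk 1) : pairSq a b z = 0 := by
    rw [ha_def, hb_def, pairSq_cutoff,
      image_eq_zero_of_notMem_tsupport (fun h => hz (hζs h))]
    simp
  have hQ := hmain ha hb hac hbc hout fun l hl => by
    refine (lintegral_weight_dbarSq_cutoff_le hU hf hDU' hlap hζ hζs hζM hl).trans ?_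
    refine (add_le_add (mul_le_mul_right hW.le _) (mul_le_mul_right hE _)).trans ?_
    rw [← ENNReal.ofReal_mul (by positivity), ← ENNReal.ofReal_mul (by positivity),
      ← ENNReal.ofReal_add (by positivity) (by positivity)]
    refine ENNReal.ofReal_le_ofReal (le_of_eq ?_)
    field_simp
  have hpt (z : ℝ × ℝ) (hz : z ∈ disk (1 / 2)) :
      ENNReal.ofReal (√(gradSq f z) ^ p + ‖fderiv ℝ (fderiv ℝ f) z‖ ^ p) ≤
      ENNReal.ofReal (K ^ p) * (ENNReal.ofReal ((K ^ 2)⁻¹) * ENNReal.ofReal (gradSq f z) +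
        (1 + ENNReal.ofReal (2 ^ p) * ENNReal.ofReal (√(pairGradSq a b z) ^ p))) := by
    have hzU := hDU' (hhalf hz)
    have hg := gradSq_nonneg (f := f) z
    have hζ1 : ζ =ᶠ[nhds z] fun _ => K⁻¹ := by
      filter_upwards [hη1 z hz] with y hy
      simp [hζdef, hy]
    have hQz := pairGradSq_cutoff_of_eventuallyEq hζ1 hU hf hzU
    have h2 := norm_fderiv_fderiv_le hU hf hzU
    have h3 : √(pairGradSq (pd1 f) (pd2 f) z) = K * √(pairGradSq a b z) := by
      rw [hQz, Real.sqrt_mul (by positivity), Real.sqrt_sq (by positivity)]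
      field_simp
    rw [h3] at h2
    have h4 : √(gradSq f z) = K * √((K ^ 2)⁻¹ * gradSq f z) := by
      rw [Real.sqrt_mul (by positivity), Real.sqrt_inv, Real.sqrt_sq hK.le]
      field_simp
    have h5 := rpow_le_mul_sq_add (Real.sqrt_nonneg ((K ^ 2)⁻¹ * gradSq f z)) one_pos hp0 hp2
    rw [Real.sq_sqrt (by positivity), Real.one_rpow, Real.one_rpow, one_mul] at h5
    rw [← ENNReal.ofReal_one, ← ENNReal.ofReal_mul (by positivity),
      ← ENNReal.ofReal_mul (by positivity), ← ENNReal.ofReal_add (by positivity) (by positivity),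
      ← ENNReal.ofReal_add (by positivity) (by positivity), ← ENNReal.ofReal_mul (by positivity)]
    refine ENNReal.ofReal_le_ofReal ?_
    calc √(gradSq f z) ^ p + ‖fderiv ℝ (fderiv ℝ f) z‖ ^ p
        ≤ (K * √((K ^ 2)⁻¹ * gradSq f z)) ^ p + (2 * (K * √(pairGradSq a b z))) ^ p := by
          rw [← h4]; gcongr
      _ = K ^ p * (√((K ^ 2)⁻¹ * gradSq f z) ^ p + 2 ^ p * √(pairGradSq a b z) ^ p) := by
          rw [Real.mul_rpow hK.le (Real.sqrt_nonneg _), Real.mul_rpow two_pos.le (by positivity),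
            Real.mul_rpow hK.le (Real.sqrt_nonneg _)]
          ring
      _ ≤ K ^ p * ((K ^ 2)⁻¹ * gradSq f z + 1 + 2 ^ p * √(pairGradSq a b z) ^ p) := by gcongr
      _ = _ := by ring
  have hQc := continuous_pairGradSq ha hb
  have hint : ∫⁻ z in disk (1/2),
      ENNReal.ofReal (Real.sqrt (gradSq f z) ^ p + ‖fderiv ℝ (fderiv ℝ f) z‖ ^ p) ≤
      ENNReal.ofReal (K ^ p * (1 + (V + 2 ^ p * C))) := by
    refine (setLIntegral_mono' (isOpen_disk _).measurableSet hpt).trans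
      ((lintegral_mono_set hhalf).trans ?_)
    rw [lintegral_const_mul' _ _ ENNReal.ofReal_ne_top, lintegral_add_right _ (by fun_prop),
      lintegral_add_left measurable_const, lintegral_const_mul' _ _ ENNReal.ofReal_ne_top,
      lintegral_const_mul' _ _ ENNReal.ofReal_ne_top, setLIntegral_one,
      ENNReal.ofReal_mul (by positivity), ENNReal.ofReal_add (by positivity) (by positivity),
      ENNReal.ofReal_add hV0 (by positivity), ENNReal.ofReal_mul (p := 2 ^ p) (by positivity), hV,
      ENNReal.ofReal_toReal volume_disk_one_lt_top.ne]
    gcongr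
    refine (mul_le_mul_right hE _).trans ?_
    rw [← ENNReal.ofReal_mul (by positivity), inv_mul_cancel₀ (by positivity)]
  refine (ENNReal.rpow_le_rpow hint (by positivity)).trans (le_of_eq ?_)
  rw [ENNReal.ofReal_rpow_of_nonneg (by positivity) (by positivity),
    Real.mul_rpow (by positivity) (by positivity), ← Real.rpow_mul hK.le,
    mul_one_div_cancel hp0.ne', Real.rpow_one, mul_comm]

/-- ε-regularity (Proposition 2.1). -/
theorem epsilon_regularity (n : ℕ) (hn : 1 ≤ n) (p : ℝ) (hp1 : 1 < p) (hp2 : p < 2) :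
    ∃ ε₀ > (0:ℝ), ∃ C > (0:ℝ),
      ∀ f : ℝ × ℝ → EuclideanSpace ℝ (Fin n),
        (∃ U : Set (ℝ × ℝ), IsOpen U ∧ closedDisk 1 ⊆ U ∧ ContDiffOn ℝ (⊤ : ℕ∞) f U) →
        (∀ z ∈ disk 1, fderiv ℝ f z = 0 → lap f z = 0) →
        willmore f (disk 1) < ENNReal.ofReal (ε₀ ^ 2) →
        (∫⁻ z in disk (1/2),
            ENNReal.ofReal (Real.sqrt (gradSq f z) ^ p + ‖fderiv ℝ (fderiv ℝ f) z‖ ^ p))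
          ^ (1 / p)
        ≤ ENNReal.ofReal C *
          (∫⁻ z in disk 1, ENNReal.ofReal (gradSq f z)) ^ ((1:ℝ) / 2) := by
  obtain ⟨ε₀, hε, C, hC, h⟩ := exists_epsilon_regularity_of_energy_le hp1 hp2
  refine ⟨ε₀, hε, C, hC, fun f hf hlap hW => ?_⟩
  have h := h f hf hlap hW
  set I := ∫⁻ z in disk 1, ENNReal.ofReal (gradSq f z)
  rcases eq_or_ne I ⊤ with hI | hI
  · rw [hI, ENNReal.top_rpow_of_pos (by norm_num),
      ENNReal.mul_top (ENNReal.ofReal_pos.2 hC).ne']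
    exact le_top
  set k := √I.toReal with hk
  have hIk : I ^ ((1 : ℝ) / 2) = ENNReal.ofReal k := by
    rw [hk, Real.sqrt_eq_rpow, ← ENNReal.ofReal_rpow_of_nonneg ENNReal.toReal_nonneg (by norm_num),
      ENNReal.ofReal_toReal hI]
  rw [hIk, ← ENNReal.ofReal_mul hC.le]
  have hlim : Tendsto (fun K => ENNReal.ofReal (C * K)) (nhdsWithin k (Ioi k))
      (nhds (ENNReal.ofReal (C * k))) :=
    (ENNReal.continuous_ofReal.comp (continuous_const_mul C)).continuousWithinAt
  refine ge_of_tendsto hlim ?_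
  filter_upwards [self_mem_nhdsWithin] with K hK
  have hk0 : 0 ≤ k := Real.sqrt_nonneg _
  have hK' : k < K := hK
  refine h K (hk0.trans_lt hK') ?_
  rw [← ENNReal.ofReal_toReal hI, ← Real.sq_sqrt (ENNReal.toReal_nonneg (a := I))]
  exact ENNReal.ofReal_le_ofReal (pow_le_pow_left₀ hk0 hK'.le 2)
end

section
/- (Gap constant, Proposition 2.2 for the flat torus) For every dimension n ≥ 1 and every R > 0 there exists a constant ε₁ > 0 with the following property: if f : ℝ² → ℝⁿ is smooth, ℤ²-periodic (f(x + m) = f(x) for all x ∈ ℝ² and m ∈ ℤ²), satisfies |f(x)| ≤ R for all x, Δf(z) = 0 at every point z where ∇f(z) = 0, and the Willmore energy over a fundamental domain satisfies W(f, [0,1]²) < ε₁², then f is constant. -/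
open MeasureTheory Set Filter
open scoped ENNReal Real RealInnerProductSpace

namespace TorusGap

open scoped ComplexConjugate

section Discrete

/-- Cauchy–Schwarz for the lower Lebesgue integral, in squared form. -/
theorem lintegral_sq_le_of_sq_le {α : Type*} [MeasurableSpace α] {μ : Measure α}
    {h F G : α → ℝ≥0∞} (hF : AEMeasurable F μ) (hG : AEMeasurable G μ)
    (hle : ∀ x, h x ^ 2 ≤ F x * G x) :
    (∫⁻ x, h x ∂μ) ^ 2 ≤ (∫⁻ x, F x ∂μ) * ∫⁻ x, G x ∂μ := by
  have hsq : ∀ a : ℝ≥0∞, (a ^ (1 / 2 : ℝ)) ^ (2 : ℝ) = a := fun a => by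
    rw [← ENNReal.rpow_mul]; norm_num
  have h1 : ∀ x, h x ≤ ((fun x => F x ^ (1 / 2 : ℝ)) * fun x => G x ^ (1 / 2 : ℝ)) x := fun x => by
    rw [Pi.mul_apply, ← ENNReal.mul_rpow_of_nonneg _ _ (by norm_num),
      one_div, ENNReal.le_rpow_inv_iff (by norm_num)]
    exact_mod_cast hle x
  have h2 := (lintegral_mono h1).trans (ENNReal.lintegral_mul_le_Lp_mul_Lq μ
    (Real.holderConjugate_iff.mpr ⟨by norm_num, by norm_num⟩ : (2 : ℝ).HolderConjugate 2)
    (hF.pow_const _) (hG.pow_const _))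
  simp only [hsq] at h2
  rw [← ENNReal.mul_rpow_of_nonneg _ _ (by norm_num),
    one_div, ENNReal.le_rpow_inv_iff (by norm_num)] at h2
  exact_mod_cast h2

/-- Cauchy–Schwarz for `ℝ≥0∞`-valued sums, in squared form. -/
theorem tsum_sq_le_of_sq_le {ι : Type*} {h F G : ι → ℝ≥0∞} (hle : ∀ x, h x ^ 2 ≤ F x * G x) :
    (∑' x, h x) ^ 2 ≤ (∑' x, F x) * ∑' x, G x := by
  let _ : MeasurableSpace ι := ⊤
  simpa only [lintegral_count] using
    lintegral_sq_le_of_sq_le (μ := Measure.count) (measurable_from_top (f := F)).aemeasurable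
      (measurable_from_top (f := G)).aemeasurable hle

/-- The sup-norm of a lattice point, as a natural number. -/
def wt (k : ℤ × ℤ) : ℕ := max k.1.natAbs k.2.natAbs

theorem wt_eq_zero {k : ℤ × ℤ} : wt k = 0 ↔ k = 0 := by
  simp [wt, Prod.ext_iff]

theorem tsum_inv_wt_le (N : ℕ) :
    ∑' k : ℤ × ℤ, (if 0 < wt k ∧ wt k ≤ N then ((wt k : ℝ≥0∞))⁻¹ else 0) ≤ 8 * N := by
  have h1 : ∀ k : ℤ × ℤ, (if 0 < wt k ∧ wt k ≤ N then ((wt k : ℝ≥0∞))⁻¹ else 0)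
      = ∑ n ∈ Finset.Icc 1 N,
        ∑ j ∈ (Finset.box n : Finset (ℤ × ℤ)), if k = j then (n : ℝ≥0∞)⁻¹ else 0 := by
    intro k
    simp only [Finset.sum_ite_eq, Int.mem_box]
    change _ = if wt k ∈ Finset.Icc 1 N then (wt k : ℝ≥0∞)⁻¹ else 0
    simp [Finset.mem_Icc, Nat.one_le_iff_ne_zero, Nat.pos_iff_ne_zero]
  simp only [h1]
  rw [Summable.tsum_finsetSum fun _ _ => ENNReal.summable]
  have h2 : ∀ n ∈ Finset.Icc 1 N, ∑' k : ℤ × ℤ,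
      ∑ j ∈ (Finset.box n : Finset (ℤ × ℤ)), (if k = j then (n : ℝ≥0∞)⁻¹ else 0) = 8 := by
    intro n hn
    have hn0 : n ≠ 0 := by rw [Finset.mem_Icc] at hn; omega
    rw [Summable.tsum_finsetSum fun _ _ => ENNReal.summable]
    simp only [tsum_ite_eq, Finset.sum_const, Int.card_box hn0, nsmul_eq_mul]
    push_cast
    rw [mul_assoc, ENNReal.mul_inv_cancel (by exact_mod_cast hn0) (by simp), mul_one]
  rw [Finset.sum_congr rfl h2]
  simp [mul_comm]

theorem trilinear_half_sq_le (a c : ℤ × ℤ → ℝ≥0∞) (ha : a 0 = 0) :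
    (∑' p : (ℤ × ℤ) × (ℤ × ℤ), if wt p.1 ≤ wt p.2 then a p.1 * a p.2 * c (p.1 + p.2) else 0) ^ 2
      ≤ 8 * (∑' k, wt k * a k ^ 2) ^ 2 * ∑' k, c k ^ 2 := by
  have hF : ∑' p : (ℤ × ℤ) × (ℤ × ℤ), (wt p.1 * a p.1 ^ 2) * c (p.1 + p.2) ^ 2
      = (∑' k, wt k * a k ^ 2) * ∑' k, c k ^ 2 := by
    rw [ENNReal.tsum_prod', ← ENNReal.tsum_mul_right]
    refine tsum_congr fun k => ?_
    dsimp only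
    rw [ENNReal.tsum_mul_left]
    congr 1
    exact (Equiv.addLeft k).tsum_eq (fun m => c m ^ 2)
  have hG : ∑' p : (ℤ × ℤ) × (ℤ × ℤ),
      a p.2 ^ 2 * (if 0 < wt p.1 ∧ wt p.1 ≤ wt p.2 then ((wt p.1 : ℝ≥0∞))⁻¹ else 0)
      ≤ 8 * ∑' k, wt k * a k ^ 2 := by
    rw [ENNReal.tsum_prod', ENNReal.tsum_comm, ← ENNReal.tsum_mul_left]
    refine ENNReal.tsum_le_tsum fun l => ?_
    dsimp only
    rw [ENNReal.tsum_mul_left]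
    calc _ ≤ a l ^ 2 * (8 * wt l) := by gcongr; exact tsum_inv_wt_le _
      _ = _ := by ring
  have key := tsum_sq_le_of_sq_le
    (h := fun p : (ℤ × ℤ) × (ℤ × ℤ) =>
      if wt p.1 ≤ wt p.2 then a p.1 * a p.2 * c (p.1 + p.2) else 0)
    (F := fun p => (wt p.1 * a p.1 ^ 2) * c (p.1 + p.2) ^ 2)
    (G := fun p => a p.2 ^ 2 * (if 0 < wt p.1 ∧ wt p.1 ≤ wt p.2 then ((wt p.1 : ℝ≥0∞))⁻¹ else 0))
    (by
      rintro ⟨k, l⟩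
      dsimp only
      by_cases hkl : wt k ≤ wt l
      swap
      · simp [hkl]
      rcases Nat.eq_zero_or_pos (wt k) with hk | hk
      · rw [wt_eq_zero.mp hk]; simp [ha]
      have : (wt k : ℝ≥0∞) * (wt k : ℝ≥0∞)⁻¹ = 1 :=
        ENNReal.mul_inv_cancel (by exact_mod_cast hk.ne') (by simp)
      rw [if_pos hkl, if_pos ⟨hk, hkl⟩]
      apply le_of_eq
      calc _ = (a k ^ 2 * a l ^ 2 * c (k + l) ^ 2) * 1 := by ring
        _ = _ := by rw [← this]; ring)
  refine key.trans ?_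
  rw [hF]
  calc _ ≤ ((∑' k, wt k * a k ^ 2) * ∑' k, c k ^ 2) * (8 * ∑' k, wt k * a k ^ 2) := by gcongr
    _ = _ := by ring

/-- The trilinear estimate behind the embedding `H^{1/2}(𝕋²) ⊂ L⁴(𝕋²)`. -/
theorem trilinear_sq_le (a c : ℤ × ℤ → ℝ≥0∞) (ha : a 0 = 0) :
    (∑' m, c m * ∑' k, a (m - k) * a k) ^ 2
      ≤ 32 * (∑' k, wt k * a k ^ 2) ^ 2 * ∑' k, c k ^ 2 := by
  set X := ∑' p : (ℤ × ℤ) × (ℤ × ℤ),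
    if wt p.1 ≤ wt p.2 then a p.1 * a p.2 * c (p.1 + p.2) else 0 with hX
  have h1 : ∑' m, c m * ∑' k, a (m - k) * a k
      = ∑' p : (ℤ × ℤ) × (ℤ × ℤ), a p.1 * a p.2 * c (p.1 + p.2) := by
    simp only [← ENNReal.tsum_mul_left]
    rw [ENNReal.tsum_comm, ENNReal.tsum_prod' (α := ℤ × ℤ)]
    refine tsum_congr fun k => ?_
    dsimp only
    rw [← (Equiv.addLeft k).tsum_eq fun m => c m * (a (m - k) * a k)]
    refine tsum_congr fun l => ?_
    simp only [Equiv.coe_addLeft, add_sub_cancel_left]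
    ring
  have hswap : X = ∑' p : (ℤ × ℤ) × (ℤ × ℤ),
      if wt p.2 ≤ wt p.1 then a p.1 * a p.2 * c (p.1 + p.2) else 0 := by
    rw [hX, ← (Equiv.prodComm (ℤ × ℤ) (ℤ × ℤ)).tsum_eq fun p =>
      if wt p.2 ≤ wt p.1 then a p.1 * a p.2 * c (p.1 + p.2) else 0]
    refine tsum_congr fun p => ?_
    change _ = if wt p.1 ≤ wt p.2 then a p.2 * a p.1 * c (p.2 + p.1) else 0
    rw [add_comm p.2, mul_comm (a p.2)]
  have h2 : ∑' p : (ℤ × ℤ) × (ℤ × ℤ), a p.1 * a p.2 * c (p.1 + p.2) ≤ X + X := by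
    nth_rw 2 [hswap]
    rw [hX, ← ENNReal.tsum_add]
    refine ENNReal.tsum_le_tsum fun p => ?_
    rcases le_total (wt p.1) (wt p.2) with h | h
    · rw [if_pos h]; exact le_self_add
    · rw [if_pos h]; exact le_add_self
  calc _ ≤ (X + X) ^ 2 := by rw [h1]; gcongr
    _ = 4 * X ^ 2 := by ring
    _ ≤ 4 * (8 * (∑' k, wt k * a k ^ 2) ^ 2 * ∑' k, c k ^ 2) := by
        gcongr; exact trilinear_half_sq_le a c ha
    _ = _ := by ring

end Discrete

section Fourier

noncomputable local instance : MeasureSpace UnitAddCircle := ⟨AddCircle.haarAddCircle⟩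

/-- The closed unit square. -/
abbrev unitSq : Set (ℝ × ℝ) := Icc (0 : ℝ) 1 ×ˢ Icc (0 : ℝ) 1

/-- The character `z ↦ exp (2πi k·z)`. -/
noncomputable def chr (k : ℤ × ℤ) (z : ℝ × ℝ) : ℂ :=
  Complex.exp (2 * π * Complex.I * (k.1 * z.1 + k.2 * z.2))

/-- The Fourier coefficients over the unit square. -/
noncomputable def coef (G : ℝ × ℝ → ℂ) (k : ℤ × ℤ) : ℂ := ∫ z in unitSq, chr (-k) z * G z

/-- Representatives in `(0, 1]²` of points of the torus. -/
noncomputable def rep (x : UnitAddTorus (Fin 2)) : ℝ × ℝ :=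
  MeasurableEquiv.finTwoArrow (UnitAddTorus.measurableEquivPiIoc (0 : Fin 2 → ℝ) x).1

theorem measurable_rep : Measurable rep :=
  MeasurableEquiv.finTwoArrow.measurable.comp
    (measurable_subtype_coe.comp (UnitAddTorus.measurableEquivPiIoc (0 : Fin 2 → ℝ)).measurable)

theorem rep_coe {x : Fin 2 → ℝ} (hx : ∀ i, x i ∈ Ioc ((0 : Fin 2 → ℝ) i) ((0 : Fin 2 → ℝ) i + 1)) :
    rep (fun i => (x i : UnitAddCircle)) = (x 0, x 1) := by
  have := (UnitAddTorus.measurableEquivPiIoc (0 : Fin 2 → ℝ)).apply_symm_apply ⟨x, hx⟩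
  rw [UnitAddTorus.coe_symm_measurableEquivPiIoc_apply] at this
  rw [rep, this]
  rfl

theorem rep_mem (x : UnitAddTorus (Fin 2)) : rep x ∈ unitSq := by
  have h := (UnitAddTorus.measurableEquivPiIoc (0 : Fin 2 → ℝ) x).2
  have h0 := h 0
  have h1 := h 1
  simp only [Pi.zero_apply, zero_add] at h0 h1
  exact ⟨Ioc_subset_Icc_self h0, Ioc_subset_Icc_self h1⟩

theorem coe_rep (x : UnitAddTorus (Fin 2)) :
    x = ![((rep x).1 : UnitAddCircle), ((rep x).2 : UnitAddCircle)] := by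
  have h := (UnitAddTorus.measurableEquivPiIoc (0 : Fin 2 → ℝ)).symm_apply_apply x
  rw [UnitAddTorus.coe_symm_measurableEquivPiIoc] at h
  funext i
  fin_cases i
  · exact (congrFun h 0).symm
  · exact (congrFun h 1).symm

theorem integral_rep (h : ℝ × ℝ → ℂ) :
    ∫ x : UnitAddTorus (Fin 2), h (rep x) = ∫ z in unitSq, h z := by
  rw [UnitAddTorus.integral_preimage _ (0 : Fin 2 → ℝ)]
  have hs : MeasurableSet {x : Fin 2 → ℝ |
      ∀ i, x i ∈ Ioc ((0 : Fin 2 → ℝ) i) ((0 : Fin 2 → ℝ) i + 1)} :=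
    MeasurableSet.univ_pi' fun i => measurableSet_Ioc
  rw [setIntegral_congr_fun hs (g := fun x => h (MeasurableEquiv.finTwoArrow x))
    fun x hx => by dsimp only; rw [rep_coe hx]; rfl]
  have he : {x : Fin 2 → ℝ | ∀ i, x i ∈ Ioc ((0 : Fin 2 → ℝ) i) ((0 : Fin 2 → ℝ) i + 1)}
      = MeasurableEquiv.finTwoArrow ⁻¹' (Ioc (0 : ℝ) 1 ×ˢ Ioc (0 : ℝ) 1) := by
    ext x
    simp [Fin.forall_fin_two, MeasurableEquiv.finTwoArrow]
  rw [he, (volume_preserving_finTwoArrow ℝ).setIntegral_preimage_emb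
    MeasurableEquiv.finTwoArrow.measurableEmbedding]
  refine setIntegral_congr_set ?_
  exact Measure.set_prod_ae_eq Ioc_ae_eq_Icc Ioc_ae_eq_Icc

theorem mFourier_rep (k : Fin 2 → ℤ) (x : UnitAddTorus (Fin 2)) :
    UnitAddTorus.mFourier k x = chr (k 0, k 1) (rep x) := by
  conv_lhs => rw [coe_rep x]
  simp only [UnitAddTorus.mFourier, ContinuousMap.coe_mk, Fin.prod_univ_two,
    Matrix.cons_val_zero, Matrix.cons_val_one, fourier_coe_apply, ← Complex.exp_add, chr]
  congr 1
  push_cast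
  ring

theorem mFourierCoeff_rep (G : ℝ × ℝ → ℂ) (k : Fin 2 → ℤ) :
    UnitAddTorus.mFourierCoeff (fun x => G (rep x)) k = coef G (k 0, k 1) := by
  rw [UnitAddTorus.mFourierCoeff, coef, ← integral_rep]
  refine integral_congr_ae (.of_forall fun x => ?_)
  simp [mFourier_rep]

theorem memLp_rep {G : ℝ × ℝ → ℂ} (hG : Continuous G) :
    MemLp (fun x : UnitAddTorus (Fin 2) => G (rep x)) 2 volume := by
  have : IsProbabilityMeasure (volume : Measure UnitAddCircle) :=
    inferInstanceAs (IsProbabilityMeasure AddCircle.haarAddCircle)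
  obtain ⟨C, hC⟩ := (isCompact_Icc.prod isCompact_Icc : IsCompact unitSq).exists_bound_of_continuousOn
    hG.continuousOn
  exact MemLp.of_bound (hG.measurable.comp measurable_rep).aestronglyMeasurable C
    (.of_forall fun x => hC _ (rep_mem x))

/-- Parseval's identity on the unit square. -/
theorem hasSum_conj_coef_mul_coef {F G : ℝ × ℝ → ℂ} (hF : Continuous F) (hG : Continuous G) :
    HasSum (fun k => conj (coef F k) * coef G k) (∫ z in unitSq, conj (F z) * G z) := by
  have h := UnitAddTorus.hasSum_prod_mFourierCoeff ((memLp_rep hF).toLp _) ((memLp_rep hG).toLp _)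
  have hc : ∀ {H : ℝ × ℝ → ℂ} (hH : Continuous H) (k : Fin 2 → ℤ),
      UnitAddTorus.mFourierCoeff ((memLp_rep hH).toLp _) k = coef H (k 0, k 1) := by
    intro H hH k
    rw [← mFourierCoeff_rep]
    refine integral_congr_ae ?_
    filter_upwards [(memLp_rep hH).coeFn_toLp] with x hx
    rw [hx]
  have hi : ∫ t, conj ((memLp_rep hF).toLp _ t) * (memLp_rep hG).toLp _ t
      = ∫ z in unitSq, conj (F z) * G z := by
    rw [← integral_rep]
    refine integral_congr_ae ?_
    filter_upwards [(memLp_rep hF).coeFn_toLp, (memLp_rep hG).coeFn_toLp] with x hx hx'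
    rw [hx, hx']
  rw [hi] at h
  refine (finTwoArrowEquiv ℤ).hasSum_iff.mp (h.congr_fun fun k => ?_)
  exact (congrArg₂ (fun u v => conj u * v) (hc hF k) (hc hG k)).symm

end Fourier

section Plane

theorem chr_add (j k : ℤ × ℤ) (z : ℝ × ℝ) : chr (j + k) z = chr j z * chr k z := by
  simp only [chr, ← Complex.exp_add]
  congr 1
  simp only [Prod.fst_add, Prod.snd_add]
  push_cast
  ring

theorem chr_zero (z : ℝ × ℝ) : chr 0 z = 1 := by simp [chr]

theorem conj_chr (k : ℤ × ℤ) (z : ℝ × ℝ) : conj (chr k z) = chr (-k) z := by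
  simp only [chr, ← Complex.exp_conj]
  congr 1
  simp [Complex.conj_ofNat]
  ring

theorem contDiff_chr (k : ℤ × ℤ) : ContDiff ℝ 1 (chr k) := by
  have h1 : ContDiff ℝ 1 fun z : ℝ × ℝ => (z.1 : ℂ) := Complex.ofRealCLM.contDiff.comp contDiff_fst
  have h2 : ContDiff ℝ 1 fun z : ℝ × ℝ => (z.2 : ℂ) := Complex.ofRealCLM.contDiff.comp contDiff_snd
  exact (contDiff_const.mul ((contDiff_const.mul h1).add (contDiff_const.mul h2))).cexp

theorem fderiv_chr (k : ℤ × ℤ) (z v : ℝ × ℝ) :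
    fderiv ℝ (chr k) z v = 2 * π * Complex.I * (k.1 * v.1 + k.2 * v.2) * chr k z := by
  have h1 : HasFDerivAt (fun z : ℝ × ℝ => (z.1 : ℂ))
      (Complex.ofRealCLM.comp (ContinuousLinearMap.fst ℝ ℝ ℝ)) z :=
    (Complex.ofRealCLM.comp (ContinuousLinearMap.fst ℝ ℝ ℝ)).hasFDerivAt
  have h2 : HasFDerivAt (fun z : ℝ × ℝ => (z.2 : ℂ))
      (Complex.ofRealCLM.comp (ContinuousLinearMap.snd ℝ ℝ ℝ)) z :=
    (Complex.ofRealCLM.comp (ContinuousLinearMap.snd ℝ ℝ ℝ)).hasFDerivAt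
  have h := (((h1.const_mul (k.1 : ℂ)).add (h2.const_mul (k.2 : ℂ))).const_mul
    (2 * π * Complex.I : ℂ)).cexp
  have h' : HasFDerivAt (chr k) _ z := h
  rw [h'.fderiv]
  simp [chr]
  ring

/-- Invariance under integer translations. -/
def IsPer {E : Type*} (G : ℝ × ℝ → E) : Prop :=
  ∀ (x : ℝ × ℝ) (m : ℤ × ℤ), G (x.1 + m.1, x.2 + m.2) = G x

theorem isPer_chr (k : ℤ × ℤ) : IsPer (chr k) := by
  intro x m
  simp only [chr]
  rw [Complex.exp_eq_exp_iff_exists_int]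
  refine ⟨k.1 * m.1 + k.2 * m.2, ?_⟩
  push_cast
  ring

theorem IsPer.fderiv {E : Type*} [NormedAddCommGroup E] [NormedSpace ℝ E] {G : ℝ × ℝ → E}
    (hG : IsPer G) (v : ℝ × ℝ) : IsPer fun z => _root_.fderiv ℝ G z v := by
  intro x m
  have h : (fun z : ℝ × ℝ => G (z + ((m.1 : ℝ), (m.2 : ℝ)))) = G := funext fun z => hG z m
  have h2 := fderiv_comp_add_right (𝕜 := ℝ) (f := G) (x := x) ((m.1 : ℝ), (m.2 : ℝ))
  rw [h] at h2
  change _root_.fderiv ℝ G (x + ((m.1 : ℝ), (m.2 : ℝ))) v = _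
  rw [← h2]

theorem isCompact_unitSq : IsCompact unitSq := isCompact_Icc.prod isCompact_Icc

theorem unitSq_eq : unitSq = Icc ((0, 0) : ℝ × ℝ) (1, 1) := Icc_prod_Icc _ _ _ _

theorem integrableOn_unitSq {E : Type*} [NormedAddCommGroup E] {G : ℝ × ℝ → E}
    (hG : Continuous G) : IntegrableOn G unitSq :=
  hG.continuousOn.integrableOn_compact isCompact_unitSq

theorem integral_fderiv_eq_zero {H : ℝ × ℝ → ℂ} (hH : ContDiff ℝ 1 H) (hp : IsPer H) (v : ℝ × ℝ) :
    ∫ z in unitSq, fderiv ℝ H z v = 0 := by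
  have hd : ∀ z, HasFDerivAt H (fderiv ℝ H z) z := fun z =>
    (hH.differentiable one_ne_zero z).hasFDerivAt
  have hc : ∀ w : ℝ × ℝ, Continuous fun z => fderiv ℝ H z w := fun w =>
    (hH.continuous_fderiv one_ne_zero).clm_apply continuous_const
  have hcH := hH.continuous
  have hv : ∀ z, fderiv ℝ H z v =
      (v.1 • fderiv ℝ H z) (1, 0) + (v.2 • fderiv ℝ H z) (0, 1) := by
    intro z
    simp only [_root_.smul_apply, ← map_smul, ← map_add]
    congr 1
    simp
  simp only [hv]
  rw [unitSq_eq, integral_divergence_prod_Icc_of_hasFDerivAt_of_le (fun z => v.1 • H z)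
    (fun z => v.2 • H z) (fun z => v.1 • fderiv ℝ H z) (fun z => v.2 • fderiv ℝ H z) (0, 0) (1, 1)
    (by simp [Prod.le_def]) (by fun_prop) (by fun_prop)
    (fun z _ => (hd z).fun_const_smul _) (fun z _ => (hd z).fun_const_smul _) ?_]
  · have h1 : ∀ x : ℝ, H (x, 1) = H (x, 0) := fun x => by simpa using hp (x, 0) (0, 1)
    have h2 : ∀ y : ℝ, H (1, y) = H (0, y) := fun y => by simpa using hp (0, y) (1, 0)
    simp [h1, h2]
  · rw [← unitSq_eq]
    refine integrableOn_unitSq ?_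
    simpa only [← hv] using hc v

theorem coef_fderiv {G : ℝ × ℝ → ℂ} (hG : ContDiff ℝ 1 G) (hp : IsPer G) (v : ℝ × ℝ) (k : ℤ × ℤ) :
    coef (fun z => fderiv ℝ G z v) k
      = 2 * π * Complex.I * (k.1 * v.1 + k.2 * v.2) * coef G k := by
  have h := integral_fderiv_eq_zero ((contDiff_chr (-k)).mul hG)
    (fun x m => by simp only [isPer_chr (-k) x m, hp x m]) v
  have hcG : Continuous fun z => fderiv ℝ G z v :=
    (hG.continuous_fderiv one_ne_zero).clm_apply continuous_const
  have hcc := (contDiff_chr (-k)).continuous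
  have hc := hG.continuous
  have h1 : ∀ z, fderiv ℝ (fun z => chr (-k) z * G z) z v = chr (-k) z * fderiv ℝ G z v
      - 2 * π * Complex.I * (k.1 * v.1 + k.2 * v.2) * (chr (-k) z * G z) := by
    intro z
    rw [fderiv_fun_mul ((contDiff_chr (-k)).differentiable one_ne_zero z)
      (hG.differentiable one_ne_zero z)]
    simp [fderiv_chr]
    ring
  simp only [h1] at h
  rw [integral_sub (integrableOn_unitSq (by fun_prop)) (integrableOn_unitSq (by fun_prop)),
    integral_const_mul, sub_eq_zero] at h
  exact h

theorem coef_one (k : ℤ × ℤ) : coef (fun _ => 1) k = if k = 0 then 1 else 0 := by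
  split_ifs with hk
  · simp [coef, hk, chr_zero, Measure.real, Measure.volume_eq_prod, Measure.prod_prod,
      -Icc_prod_Icc]
  · have h : ∀ v : ℝ × ℝ, 2 * π * Complex.I * (k.1 * v.1 + k.2 * v.2) * coef (fun _ => 1) k = 0 := by
      intro v
      rw [← coef_fderiv contDiff_const (fun _ _ => rfl)]
      simp [coef]
    by_contra h0
    apply hk
    have h1 := h (1, 0)
    have h2 := h (0, 1)
    simp [h0, Real.pi_ne_zero] at h1 h2
    exact Prod.ext h1 h2

theorem coef_chr (j k : ℤ × ℤ) : coef (chr j) k = if k = j then 1 else 0 := by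
  have : coef (chr j) k = coef (fun _ => 1) (k - j) := by
    simp only [coef, mul_one, ← chr_add]
    congr 1
    funext z
    congr 1
    abel
  rw [this, coef_one]
  simp [sub_eq_zero]

theorem tsum_enorm_coef_sq {G : ℝ × ℝ → ℂ} (hG : Continuous G) :
    ∑' k, ‖coef G k‖ₑ ^ 2 = ∫⁻ z in unitSq, ‖G z‖ₑ ^ 2 := by
  have h := Complex.hasSum_re (hasSum_conj_coef_mul_coef hG hG)
  have hconj : ∀ w : ℂ, conj w * w = ((‖w‖ ^ 2 : ℝ) : ℂ) := fun w => by
    rw [mul_comm, Complex.mul_conj, Complex.normSq_eq_norm_sq]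
  simp only [hconj, Complex.ofReal_re] at h
  rw [integral_complex_ofReal, Complex.ofReal_re] at h
  have he : ∀ w : ℂ, ‖w‖ₑ ^ 2 = ENNReal.ofReal (‖w‖ ^ 2) := fun w => by
    rw [ENNReal.ofReal_pow (norm_nonneg _), ofReal_norm]
  simp only [he]
  rw [← ENNReal.ofReal_tsum_of_nonneg (fun _ => by positivity) h.summable, h.tsum_eq,
    ofReal_integral_eq_lintegral_ofReal (integrableOn_unitSq (by fun_prop))
      (.of_forall fun _ => by positivity)]

theorem lintegral_enorm_sq_ne_top {G : ℝ × ℝ → ℂ} (hG : Continuous G) :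
    ∫⁻ z in unitSq, ‖G z‖ₑ ^ 2 ≠ ∞ := by
  have h := (integrableOn_unitSq (hG.norm.pow 2)).hasFiniteIntegral
  simpa [HasFiniteIntegral, enorm_pow] using h.ne

theorem hasSum_coef_sq {G : ℝ × ℝ → ℂ} (hG : Continuous G) (m : ℤ × ℤ) :
    HasSum (fun k => coef G (m - k) * coef G k) (coef (fun z => G z * G z) m) := by
  have h := hasSum_conj_coef_mul_coef
    (F := fun z => conj (G z) * chr m z)
    ((Complex.continuous_conj.comp hG).mul (contDiff_chr m).continuous) hG
  have h1 : ∀ k, conj (coef (fun z => conj (G z) * chr m z) k) = coef G (m - k) := by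
    intro k
    simp only [coef, ← integral_conj]
    congr 1
    funext z
    simp only [map_mul, Complex.conj_conj, conj_chr, neg_neg, neg_sub]
    rw [sub_eq_add_neg, chr_add]
    ring
  simp only [h1] at h
  convert h using 1
  rw [coef]
  congr 1
  funext z
  simp only [map_mul, Complex.conj_conj, conj_chr]
  ring

/-- The embedding `H^{1/2}(𝕋²) ⊂ L⁴(𝕋²)` for functions of mean zero. -/
theorem lintegral_enorm_pow_four_le {G : ℝ × ℝ → ℂ} (hG : Continuous G) (h0 : coef G 0 = 0) :
    ∫⁻ z in unitSq, ‖G z‖ₑ ^ 4 ≤ 32 * (∑' k, wt k * ‖coef G k‖ₑ ^ 2) ^ 2 := by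
  have hGG : Continuous fun z => G z * G z := hG.mul hG
  have hT := tsum_enorm_coef_sq hGG
  have hTtop := lintegral_enorm_sq_ne_top hGG
  have hpow : ∀ z, ‖G z * G z‖ₑ ^ 2 = ‖G z‖ₑ ^ 4 := fun z => by rw [enorm_mul]; ring
  simp only [hpow] at hT hTtop
  set T := ∫⁻ z in unitSq, ‖G z‖ₑ ^ 4
  have h1 : T ≤ ∑' m, ‖coef (fun z => G z * G z) m‖ₑ * ∑' k, ‖coef G (m - k)‖ₑ * ‖coef G k‖ₑ := by
    rw [← hT]
    refine ENNReal.tsum_le_tsum fun m => ?_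
    rw [pow_two]
    gcongr
    rw [← (hasSum_coef_sq hG m).tsum_eq]
    refine enorm_tsum_le_tsum_enorm.trans (le_of_eq ?_)
    simp only [enorm_mul]
  have h2 := trilinear_sq_le (fun k => ‖coef G k‖ₑ) (fun m => ‖coef (fun z => G z * G z) m‖ₑ)
    (by simp [h0])
  rw [hT] at h2
  have h3 : T * T ≤ (32 * (∑' k, wt k * ‖coef G k‖ₑ ^ 2) ^ 2) * T := by
    refine le_trans ?_ h2
    rw [← pow_two]
    gcongr
  rcases eq_or_ne T 0 with hz | hz
  · simp [hz]
  · exact (ENNReal.mul_le_mul_iff_left hz hTtop).mp h3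

end Plane

section Willmore

variable {n : ℕ}

/-- The `i`-th coordinate, as a complex number. -/
noncomputable def cmp (i : Fin n) : EuclideanSpace ℝ (Fin n) →L[ℝ] ℂ :=
  Complex.ofRealCLM.comp (EuclideanSpace.proj i)

theorem cmp_apply (i : Fin n) (x : EuclideanSpace ℝ (Fin n)) : cmp i x = (x i : ℂ) := rfl

theorem coef_cmp_fderiv (i : Fin n) {g : ℝ × ℝ → EuclideanSpace ℝ (Fin n)} (hg : ContDiff ℝ 1 g)
    (hp : IsPer g) (v : ℝ × ℝ) (k : ℤ × ℤ) :
    coef (fun z => cmp i (fderiv ℝ g z v)) k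
      = 2 * π * Complex.I * (k.1 * v.1 + k.2 * v.2) * coef (fun z => cmp i (g z)) k := by
  have hG : ContDiff ℝ 1 fun z => cmp i (g z) := (cmp i).contDiff.comp hg
  rw [← coef_fderiv hG (fun x m => congrArg (cmp i) (hp x m))]
  congr 1
  funext z
  have hd : HasFDerivAt (fun z => cmp i (g z)) ((cmp i).comp (fderiv ℝ g z)) z :=
    (cmp i).hasFDerivAt.comp z (hg.differentiable one_ne_zero z).hasFDerivAt
  rw [hd.fderiv]
  rfl

theorem contDiff_fderiv_apply {g : ℝ × ℝ → EuclideanSpace ℝ (Fin n)} (hg : ContDiff ℝ 2 g)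
    (v : ℝ × ℝ) : ContDiff ℝ 1 fun z => fderiv ℝ g z v :=
  (hg.fderiv_right (m := 1) (by norm_num)).clm_apply contDiff_const

variable {f : ℝ × ℝ → EuclideanSpace ℝ (Fin n)}

theorem continuous_pd1 (hf : ContDiff ℝ 1 f) : Continuous (pd1 f) :=
  (hf.continuous_fderiv one_ne_zero).clm_apply continuous_const

theorem continuous_pd2 (hf : ContDiff ℝ 1 f) : Continuous (pd2 f) :=
  (hf.continuous_fderiv one_ne_zero).clm_apply continuous_const

theorem continuous_lap (hf : ContDiff ℝ 2 f) : Continuous (lap f) :=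
  (continuous_pd1 (contDiff_fderiv_apply hf _)).add (continuous_pd2 (contDiff_fderiv_apply hf _))

theorem continuous_gradSq (hf : ContDiff ℝ 1 f) : Continuous (gradSq f) :=
  ((continuous_pd1 hf).norm.pow 2).add ((continuous_pd2 hf).norm.pow 2)

/-- The symbol `4π²|k|²` of the negative Laplacian. -/
noncomputable def symb (k : ℤ × ℤ) : ℝ := 4 * π ^ 2 * (k.1 ^ 2 + k.2 ^ 2)

theorem coef_cmp_lap (i : Fin n) (hf : ContDiff ℝ 2 f) (hp : IsPer f) (k : ℤ × ℤ) :
    coef (fun z => cmp i (lap f z)) k = -(symb k : ℂ) * coef (fun z => cmp i (f z)) k := by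
  have hf1 : ContDiff ℝ 1 f := hf.of_le (by norm_num)
  have h1 := coef_cmp_fderiv i (contDiff_fderiv_apply hf (1, 0)) (hp.fderiv _) (1, 0) k
  have h2 := coef_cmp_fderiv i (contDiff_fderiv_apply hf (0, 1)) (hp.fderiv _) (0, 1) k
  rw [coef_cmp_fderiv i hf1 hp] at h1 h2
  have hadd : coef (fun z => cmp i (lap f z)) k
      = coef (fun z => cmp i (pd1 (pd1 f) z)) k + coef (fun z => cmp i (pd2 (pd2 f) z)) k := by
    simp only [coef]
    have hc := (contDiff_chr (-k)).continuous
    have c1 : Continuous (pd1 (pd1 f)) := continuous_pd1 (contDiff_fderiv_apply hf (1, 0))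
    have c2 : Continuous (pd2 (pd2 f)) := continuous_pd2 (contDiff_fderiv_apply hf (0, 1))
    rw [← integral_add (integrableOn_unitSq (by fun_prop)) (integrableOn_unitSq (by fun_prop))]
    congr 1
    funext z
    rw [lap, map_add, mul_add]
  have h1' : coef (fun z => cmp i (pd1 (pd1 f) z)) k = _ := h1
  have h2' : coef (fun z => cmp i (pd2 (pd2 f) z)) k = _ := h2
  rw [hadd, h1', h2', symb]
  push_cast
  linear_combination (4 * π ^ 2 * (k.1 ^ 2 + k.2 ^ 2) * coef (fun z => cmp i (f z)) k : ℂ)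
    * Complex.I_sq

theorem symb_nonneg (k : ℤ × ℤ) : 0 ≤ symb k := by unfold symb; positivity

theorem two_mul_wt_sq_le_symb (k : ℤ × ℤ) : 2 * (wt k : ℝ) ^ 2 ≤ symb k := by
  have hw : (wt k : ℝ) ^ 2 ≤ (k.1 : ℝ) ^ 2 + (k.2 : ℝ) ^ 2 := by
    have h1 : ((k.1.natAbs : ℕ) : ℝ) ^ 2 = (k.1 : ℝ) ^ 2 := by
      rw [Nat.cast_natAbs, Int.cast_abs, sq_abs]
    have h2 : ((k.2.natAbs : ℕ) : ℝ) ^ 2 = (k.2 : ℝ) ^ 2 := by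
      rw [Nat.cast_natAbs, Int.cast_abs, sq_abs]
    rcases max_choice k.1.natAbs k.2.natAbs with h | h
    · rw [wt, h, h1]; nlinarith [sq_nonneg (k.2 : ℝ)]
    · rw [wt, h, h2]; nlinarith [sq_nonneg (k.1 : ℝ)]
  have hpi : 2 ≤ 4 * π ^ 2 := by nlinarith [Real.pi_gt_three]
  unfold symb
  exact mul_le_mul hpi hw (by positivity) (by positivity)

/-- The squared `H^{3/2}` seminorm of the `i`-th component. -/
noncomputable def energy (f : ℝ × ℝ → EuclideanSpace ℝ (Fin n)) (i : Fin n) : ℝ≥0∞ :=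
  ∑' k, (wt k : ℝ≥0∞) ^ 3 * ‖coef (fun z => cmp i (f z)) k‖ₑ ^ 2

theorem ofReal_two_mul_wt_sq (k : ℤ × ℤ) :
    2 * (wt k : ℝ≥0∞) ^ 2 ≤ ENNReal.ofReal (symb k) := by
  refine le_trans (le_of_eq ?_) (ENNReal.ofReal_le_ofReal (two_mul_wt_sq_le_symb k))
  rw [ENNReal.ofReal_mul (by norm_num), ENNReal.ofReal_pow (by positivity), ENNReal.ofReal_natCast]
  simp

theorem energy_ne_top (hf : ContDiff ℝ 2 f) (hp : IsPer f) (i : Fin n) : energy f i ≠ ∞ := by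
  have hc : Continuous fun z => cmp i (lap f z) := (cmp i).continuous.comp (continuous_lap hf)
  refine ne_top_of_le_ne_top (lintegral_enorm_sq_ne_top hc) ?_
  rw [← tsum_enorm_coef_sq hc]
  refine ENNReal.tsum_le_tsum fun k => ?_
  rw [coef_cmp_lap i hf hp, enorm_mul, mul_pow, enorm_neg]
  refine mul_le_mul' ?_ le_rfl
  have hs : ‖(symb k : ℂ)‖ₑ = ENNReal.ofReal (symb k) := by
    rw [← ofReal_norm, Complex.norm_of_nonneg (symb_nonneg k)]
  rw [hs]
  calc (wt k : ℝ≥0∞) ^ 3 ≤ ((wt k : ℝ≥0∞) ^ 2) ^ 2 := by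
        rw [← pow_mul]
        rcases Nat.eq_zero_or_pos (wt k) with h | h
        · simp [h]
        · exact pow_le_pow_right₀ (by exact_mod_cast h) (by norm_num)
    _ ≤ _ := by
        refine pow_le_pow_left' (le_trans ?_ (ofReal_two_mul_wt_sq k)) 2
        rw [two_mul]
        exact le_self_add

theorem lintegral_fderiv_pow_four_le (hf : ContDiff ℝ 1 f) (hp : IsPer f) (i : Fin n)
    {v : ℝ × ℝ} (hv : |v.1| + |v.2| ≤ 1) :
    ∫⁻ z in unitSq, ‖cmp i (fderiv ℝ f z v)‖ₑ ^ 4 ≤ 32 * (64 * energy f i) ^ 2 := by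
  have hc : Continuous fun z => cmp i (fderiv ℝ f z v) :=
    (cmp i).continuous.comp ((hf.continuous_fderiv one_ne_zero).clm_apply continuous_const)
  refine (lintegral_enorm_pow_four_le hc ?_).trans ?_
  · rw [coef_cmp_fderiv i hf hp]; simp
  gcongr
  rw [energy, ← ENNReal.tsum_mul_left]
  refine ENNReal.tsum_le_tsum fun k => ?_
  rw [coef_cmp_fderiv i hf hp, enorm_mul, mul_pow]
  have hb : ‖(2 * π * Complex.I * (k.1 * v.1 + k.2 * v.2) : ℂ)‖ₑ ≤ 8 * wt k := by
    have hr : ‖(2 * π * Complex.I * (k.1 * v.1 + k.2 * v.2) : ℂ)‖ ≤ 8 * wt k := by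
      have e : (k.1 * v.1 + k.2 * v.2 : ℂ) = ((k.1 * v.1 + k.2 * v.2 : ℝ) : ℂ) := by push_cast; rfl
      have h1 : |(k.1 : ℝ)| ≤ wt k := by
        rw [← Int.cast_abs, ← Nat.cast_natAbs]; exact_mod_cast le_max_left _ _
      have h2 : |(k.2 : ℝ)| ≤ wt k := by
        rw [← Int.cast_abs, ← Nat.cast_natAbs]; exact_mod_cast le_max_right _ _
      rw [e, norm_mul, norm_mul, norm_mul, Complex.norm_real, Complex.norm_real, Complex.norm_I,
        Real.norm_eq_abs, Real.norm_eq_abs, abs_of_pos Real.pi_pos, Complex.norm_two]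
      have h3 : |(k.1 * v.1 + k.2 * v.2 : ℝ)| ≤ wt k := by
        calc |(k.1 * v.1 + k.2 * v.2 : ℝ)| ≤ |(k.1 : ℝ)| * |v.1| + |(k.2 : ℝ)| * |v.2| := by
              rw [← abs_mul, ← abs_mul]; exact abs_add_le _ _
          _ ≤ wt k * |v.1| + wt k * |v.2| := by gcongr
          _ = wt k * (|v.1| + |v.2|) := by ring
          _ ≤ wt k * 1 := by gcongr
          _ = wt k := mul_one _
      have h4 : 2 * π * 1 ≤ 8 := by linarith [Real.pi_lt_four]
      exact mul_le_mul h4 h3 (abs_nonneg _) (by norm_num)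
    rw [← ofReal_norm]
    refine (ENNReal.ofReal_le_ofReal hr).trans (le_of_eq ?_)
    rw [ENNReal.ofReal_mul (by norm_num), ENNReal.ofReal_natCast]
    simp
  calc _ ≤ (wt k : ℝ≥0∞) * ((8 * wt k) ^ 2 * ‖coef (fun z => cmp i (f z)) k‖ₑ ^ 2) := by gcongr
    _ = _ := by ring

theorem ofReal_norm_sq (x : EuclideanSpace ℝ (Fin n)) :
    ENNReal.ofReal (‖x‖ ^ 2) = ∑ i, ‖cmp i x‖ₑ ^ 2 := by
  rw [EuclideanSpace.norm_sq_eq, ENNReal.ofReal_sum_of_nonneg fun _ _ => by positivity]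
  refine Finset.sum_congr rfl fun i _ => ?_
  rw [ENNReal.ofReal_pow (norm_nonneg _), cmp_apply, ← ofReal_norm, Complex.norm_real]

theorem sum_sq_le_card_mul (s : Fin n → ℝ≥0∞) : (∑ i, s i) ^ 2 ≤ n * ∑ i, s i ^ 2 := by
  simpa [tsum_fintype] using
    tsum_sq_le_of_sq_le (h := s) (F := fun _ => 1) (G := fun i => s i ^ 2) fun i => by simp

theorem add_sq_le_four_mul (x y : ℝ≥0∞) : (x + y) ^ 2 ≤ 4 * (x ^ 2 + y ^ 2) := by
  rcases le_total x y with h | h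
  · calc (x + y) ^ 2 ≤ (y + y) ^ 2 := by gcongr
      _ = 4 * y ^ 2 := by ring
      _ ≤ _ := by gcongr; exact le_add_self
  · calc (x + y) ^ 2 ≤ (x + x) ^ 2 := by gcongr
      _ = 4 * x ^ 2 := by ring
      _ ≤ _ := by gcongr; exact le_self_add

theorem lintegral_gradSq_sq_le (hf : ContDiff ℝ 1 f) (hp : IsPer f) :
    ∫⁻ z in unitSq, ENNReal.ofReal (gradSq f z) ^ 2 ≤ 2 ^ 20 * n ^ 2 * (∑ i, energy f i) ^ 2 := by
  have hm1 : ∀ i, Measurable fun z => ‖cmp i (pd1 f z)‖ₑ ^ 4 := fun i =>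
    ((cmp i).continuous.comp (continuous_pd1 hf)).enorm.measurable.pow_const 4
  have hm2 : ∀ i, Measurable fun z => ‖cmp i (pd2 f z)‖ₑ ^ 4 := fun i =>
    ((cmp i).continuous.comp (continuous_pd2 hf)).enorm.measurable.pow_const 4
  have hpt : ∀ z, ENNReal.ofReal (gradSq f z) ^ 2
      ≤ n * ∑ i, 4 * (‖cmp i (pd1 f z)‖ₑ ^ 4 + ‖cmp i (pd2 f z)‖ₑ ^ 4) := by
    intro z
    rw [gradSq, ENNReal.ofReal_add (by positivity) (by positivity), ofReal_norm_sq, ofReal_norm_sq,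
      ← Finset.sum_add_distrib]
    refine (sum_sq_le_card_mul _).trans ?_
    gcongr with i
    refine (add_sq_le_four_mul _ _).trans (le_of_eq ?_)
    ring
  refine (lintegral_mono hpt).trans ?_
  have hm : ∀ i, Measurable fun z => ‖cmp i (pd1 f z)‖ₑ ^ 4 + ‖cmp i (pd2 f z)‖ₑ ^ 4 := fun i =>
    (hm1 i).add (hm2 i)
  rw [lintegral_const_mul _ (Finset.measurable_fun_sum _ fun i _ => (hm i).const_mul _),
    lintegral_finsetSum _ fun i _ => (hm i).const_mul _]
  have hi : ∀ i, ∫⁻ z in unitSq, 4 * (‖cmp i (pd1 f z)‖ₑ ^ 4 + ‖cmp i (pd2 f z)‖ₑ ^ 4)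
      ≤ 2 ^ 20 * (∑ j, energy f j) ^ 2 := by
    intro i
    have hle : energy f i ≤ ∑ j, energy f j :=
      Finset.single_le_sum (f := energy f) (fun _ _ => zero_le) (Finset.mem_univ i)
    rw [lintegral_const_mul _ (hm i), lintegral_add_left (hm1 i)]
    calc _ ≤ 4 * (32 * (64 * energy f i) ^ 2 + 32 * (64 * energy f i) ^ 2) := by
          gcongr
          · exact lintegral_fderiv_pow_four_le hf hp i (by simp)
          · exact lintegral_fderiv_pow_four_le hf hp i (by simp)
      _ = 2 ^ 20 * energy f i ^ 2 := by ring
      _ ≤ _ := by gcongr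
  calc _ ≤ (n : ℝ≥0∞) * ∑ _i : Fin n, 2 ^ 20 * (∑ j, energy f j) ^ 2 := by
        gcongr with i
        exact hi i
    _ = _ := by simp; ring

theorem enorm_cmp_lap_sq_le (hcrit : ∀ z, fderiv ℝ f z = 0 → lap f z = 0) (i : Fin n)
    (z : ℝ × ℝ) : ‖cmp i (lap f z)‖ₑ ^ 2
      ≤ ENNReal.ofReal (‖lap f z‖ ^ 2 / gradSq f z) * ENNReal.ofReal (gradSq f z) := by
  have h0 : 0 ≤ gradSq f z := by unfold gradSq; positivity
  rw [← ENNReal.ofReal_mul (by positivity)]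
  have h1 : ‖lap f z‖ ^ 2 / gradSq f z * gradSq f z = ‖lap f z‖ ^ 2 := by
    rcases eq_or_ne (gradSq f z) 0 with h | h
    · have hz : lap f z = 0 := by
        apply hcrit
        have h1 : pd1 f z = 0 := by
          unfold gradSq at h
          have : ‖pd1 f z‖ ^ 2 = 0 := by nlinarith [sq_nonneg ‖pd1 f z‖, sq_nonneg ‖pd2 f z‖]
          simpa using this
        have h2 : pd2 f z = 0 := by
          unfold gradSq at h
          have : ‖pd2 f z‖ ^ 2 = 0 := by nlinarith [sq_nonneg ‖pd1 f z‖, sq_nonneg ‖pd2 f z‖]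
          simpa using this
        refine ContinuousLinearMap.ext fun v => ?_
        have hv : v = v.1 • ((1, 0) : ℝ × ℝ) + v.2 • ((0, 1) : ℝ × ℝ) := by ext <;> simp
        rw [hv, map_add, map_smul, map_smul]
        change v.1 • pd1 f z + v.2 • pd2 f z = 0
        simp [h1, h2]
      simp [hz]
    · field_simp
  rw [h1, ofReal_norm_sq]
  exact Finset.single_le_sum (f := fun i => ‖cmp i (lap f z)‖ₑ ^ 2) (fun _ _ => zero_le)
    (Finset.mem_univ i)

theorem willmore_unitSq (hf : ContDiff ℝ 1 f) :
    willmore f unitSq = ∫⁻ z in unitSq, ENNReal.ofReal (‖lap f z‖ ^ 2 / gradSq f z) := by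
  have hT : MeasurableSet {w | gradSq f w ≠ 0} :=
    (isOpen_ne_fun (continuous_gradSq hf) continuous_const).measurableSet
  rw [willmore, inter_comm, ← Measure.restrict_restrict hT, ← lintegral_indicator hT]
  congr 1
  funext z
  by_cases h : gradSq f z = 0
  · simp [h]
  · simp [h]

/-- The Fourier multiplier with symbol `wt`, truncated to a finite set of frequencies. -/
noncomputable def trunc (f : ℝ × ℝ → EuclideanSpace ℝ (Fin n)) (i : Fin n) (S : Finset (ℤ × ℤ))
    (z : ℝ × ℝ) : ℂ := ∑ k ∈ S, (wt k * coef (fun z => cmp i (f z)) k) * chr k z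

theorem continuous_trunc (i : Fin n) (S : Finset (ℤ × ℤ)) : Continuous (trunc f i S) :=
  continuous_finsetSum _ fun k _ => continuous_const.mul (contDiff_chr k).continuous

theorem coef_trunc (i : Fin n) (S : Finset (ℤ × ℤ)) (k : ℤ × ℤ) :
    coef (trunc f i S) k = if k ∈ S then wt k * coef (fun z => cmp i (f z)) k else 0 := by
  have h : coef (trunc f i S) k
      = ∑ j ∈ S, (wt j * coef (fun z => cmp i (f z)) j) * coef (chr j) k := by
    unfold trunc
    generalize coef (fun z => cmp i (f z)) = a
    have hch : ∀ j, Continuous (chr j) := fun j => (contDiff_chr j).continuous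
    simp only [coef, Finset.mul_sum]
    rw [integral_finsetSum _ fun j _ => integrableOn_unitSq (by fun_prop)]
    refine Finset.sum_congr rfl fun j _ => ?_
    rw [← integral_const_mul]
    congr 1
    funext z
    ring
  rw [h]
  simp [coef_chr]

theorem lintegral_trunc_pow_four_le (i : Fin n) (S : Finset (ℤ × ℤ)) :
    ∫⁻ z in unitSq, ‖trunc f i S z‖ₑ ^ 4 ≤ 32 * energy f i ^ 2 := by
  refine (lintegral_enorm_pow_four_le (continuous_trunc i S) ?_).trans ?_
  · rw [coef_trunc]; simp [wt_eq_zero.mpr rfl]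
  gcongr
  refine ENNReal.tsum_le_tsum fun k => ?_
  rw [coef_trunc]
  split_ifs
  · rw [enorm_mul, mul_pow]
    have : ‖(wt k : ℂ)‖ₑ = wt k := by
      rw [← ofReal_norm, Complex.norm_natCast, ENNReal.ofReal_natCast]
    rw [this]
    apply le_of_eq
    ring
  · simp

theorem two_mul_sum_le_lintegral (hf : ContDiff ℝ 2 f) (hp : IsPer f) (i : Fin n)
    (S : Finset (ℤ × ℤ)) :
    2 * ∑ k ∈ S, (wt k : ℝ≥0∞) ^ 3 * ‖coef (fun z => cmp i (f z)) k‖ₑ ^ 2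
      ≤ ∫⁻ z in unitSq, ‖trunc f i S z‖ₑ * ‖cmp i (lap f z)‖ₑ := by
  have hc : Continuous fun z => cmp i (lap f z) := (cmp i).continuous.comp (continuous_lap hf)
  have h := (hasSum_conj_coef_mul_coef (continuous_trunc (f := f) i S) hc).tsum_eq
  rw [tsum_eq_sum (s := S) fun k hk => by rw [coef_trunc, if_neg hk]; simp] at h
  set r : ℤ × ℤ → ℝ := fun k => symb k * wt k * ‖coef (fun z => cmp i (f z)) k‖ ^ 2 with hr
  have hr0 : ∀ k, 0 ≤ r k := fun k => by have := symb_nonneg k; positivity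
  have h1 : ∑ k ∈ S, conj (coef (trunc f i S) k) * coef (fun z => cmp i (lap f z)) k
      = -((∑ k ∈ S, r k : ℝ) : ℂ) := by
    rw [Complex.ofReal_sum, ← Finset.sum_neg_distrib]
    refine Finset.sum_congr rfl fun k hk => ?_
    rw [coef_trunc, if_pos hk, coef_cmp_lap i hf hp, map_mul, Complex.conj_natCast, hr]
    push_cast
    rw [← Complex.conj_mul']
    ring
  rw [h1] at h
  calc _ = ∑ k ∈ S, (2 * (wt k : ℝ≥0∞) ^ 2) * wt k * ‖coef (fun z => cmp i (f z)) k‖ₑ ^ 2 := by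
        rw [Finset.mul_sum]
        refine Finset.sum_congr rfl fun k _ => ?_
        ring
    _ ≤ ∑ k ∈ S, ENNReal.ofReal (r k) := by
        refine Finset.sum_le_sum fun k _ => ?_
        rw [hr]
        dsimp only
        rw [ENNReal.ofReal_mul (mul_nonneg (symb_nonneg k) (by positivity)),
          ENNReal.ofReal_mul (symb_nonneg k), ENNReal.ofReal_natCast,
          ENNReal.ofReal_pow (norm_nonneg _), ofReal_norm]
        gcongr
        exact ofReal_two_mul_wt_sq k
    _ = ‖∫ z in unitSq, conj (trunc f i S z) * cmp i (lap f z)‖ₑ := by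
        rw [← h, enorm_neg, ← ofReal_norm, Complex.norm_of_nonneg
          (Finset.sum_nonneg fun k _ => hr0 k), ENNReal.ofReal_sum_of_nonneg fun k _ => hr0 k]
    _ ≤ _ := by
        refine (enorm_integral_le_lintegral_enorm _).trans (le_of_eq ?_)
        congr 1
        funext z
        rw [enorm_mul, ← ofReal_norm (conj _), Complex.norm_conj, ofReal_norm]

theorem le_of_sq_le_sq {x y : ℝ≥0∞} (h : x ^ 2 ≤ y ^ 2) : x ≤ y :=
  (ENNReal.pow_le_pow_left_iff two_ne_zero).mp h

theorem lintegral_trunc_mul_lap_sq_le (hf : ContDiff ℝ 2 f) (hp : IsPer f)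
    (hcrit : ∀ z, fderiv ℝ f z = 0 → lap f z = 0) (i : Fin n) (S : Finset (ℤ × ℤ)) :
    (∫⁻ z in unitSq, ‖trunc f i S z‖ₑ * ‖cmp i (lap f z)‖ₑ) ^ 2
      ≤ willmore f unitSq * (2 ^ 13 * n * (∑ j, energy f j) ^ 2) := by
  have hf1 : ContDiff ℝ 1 f := hf.of_le (by norm_num)
  have hgm : Measurable fun z => ENNReal.ofReal (gradSq f z) :=
    (continuous_gradSq hf1).measurable.ennreal_ofReal
  have htm : Measurable fun z => ‖trunc f i S z‖ₑ :=
    (continuous_trunc i S).enorm.measurable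
  have hVm : Measurable fun z => ENNReal.ofReal (‖lap f z‖ ^ 2 / gradSq f z) :=
    (((continuous_lap hf).norm.pow 2).measurable.div
      (continuous_gradSq hf1).measurable).ennreal_ofReal
  have hle : energy f i ≤ ∑ j, energy f j :=
    Finset.single_le_sum (f := energy f) (fun _ _ => zero_le) (Finset.mem_univ i)
  have hJ : ∫⁻ z in unitSq, ‖trunc f i S z‖ₑ ^ 2 * ENNReal.ofReal (gradSq f z)
      ≤ 2 ^ 13 * n * (∑ j, energy f j) ^ 2 := by
    apply le_of_sq_le_sq
    calc _ ≤ (∫⁻ z in unitSq, ‖trunc f i S z‖ₑ ^ 4)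
          * ∫⁻ z in unitSq, ENNReal.ofReal (gradSq f z) ^ 2 :=
        lintegral_sq_le_of_sq_le (htm.pow_const 4).aemeasurable (hgm.pow_const 2).aemeasurable
          fun z => le_of_eq (by ring)
      _ ≤ (32 * (∑ j, energy f j) ^ 2) * (2 ^ 20 * n ^ 2 * (∑ j, energy f j) ^ 2) := by
        gcongr
        · exact (lintegral_trunc_pow_four_le i S).trans (by gcongr)
        · exact lintegral_gradSq_sq_le hf1 hp
      _ = 2 ^ 25 * (n ^ 2 * (∑ j, energy f j) ^ 4) := by ring
      _ ≤ 2 ^ 26 * (n ^ 2 * (∑ j, energy f j) ^ 4) := by gcongr <;> norm_num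
      _ = _ := by ring
  rw [willmore_unitSq hf1]
  refine (lintegral_sq_le_of_sq_le hVm.aemeasurable
    ((htm.pow_const 2).mul hgm).aemeasurable fun z => ?_).trans (mul_le_mul_right hJ _)
  rw [mul_pow]
  calc _ ≤ ‖trunc f i S z‖ₑ ^ 2 * (ENNReal.ofReal (‖lap f z‖ ^ 2 / gradSq f z)
        * ENNReal.ofReal (gradSq f z)) := by
        gcongr
        exact enorm_cmp_lap_sq_le hcrit i z
    _ = _ := by simp only [Pi.mul_apply]; ring

theorem sum_energy_eq_zero (hf : ContDiff ℝ 2 f) (hp : IsPer f)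
    (hcrit : ∀ z, fderiv ℝ f z = 0 → lap f z = 0)
    (hW : n ^ 2 * (willmore f unitSq * (2 ^ 13 * n)) ≤ 1) : ∑ i, energy f i = 0 := by
  have hi : ∀ i, n * (2 * energy f i) ≤ ∑ j, energy f j := by
    intro i
    apply le_of_sq_le_sq
    have h2 : (2 * energy f i) ^ 2
        ≤ willmore f unitSq * (2 ^ 13 * n * (∑ j, energy f j) ^ 2) := by
      have hS : ∀ S : Finset (ℤ × ℤ),
          2 * ∑ k ∈ S, (wt k : ℝ≥0∞) ^ 3 * ‖coef (fun z => cmp i (f z)) k‖ₑ ^ 2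
            ≤ (willmore f unitSq * (2 ^ 13 * n * (∑ j, energy f j) ^ 2)) ^ (1 / 2 : ℝ) := by
        intro S
        rw [one_div, ENNReal.le_rpow_inv_iff (by norm_num)]
        refine le_trans ?_ (lintegral_trunc_mul_lap_sq_le hf hp hcrit i S)
        rw [ENNReal.rpow_ofNat]
        gcongr
        exact two_mul_sum_le_lintegral hf hp i S
      have hsup : 2 * energy f i
          ≤ (willmore f unitSq * (2 ^ 13 * n * (∑ j, energy f j) ^ 2)) ^ (1 / 2 : ℝ) := by
        rw [energy, ← ENNReal.tsum_mul_left, ENNReal.tsum_eq_iSup_sum]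
        refine iSup_le fun S => ?_
        rw [← Finset.mul_sum]
        exact hS S
      rw [one_div, ENNReal.le_rpow_inv_iff (by norm_num), ENNReal.rpow_ofNat] at hsup
      exact hsup
    calc _ = (n : ℝ≥0∞) ^ 2 * (2 * energy f i) ^ 2 := by ring
      _ ≤ n ^ 2 * (willmore f unitSq * (2 ^ 13 * n * (∑ j, energy f j) ^ 2)) := by gcongr
      _ = n ^ 2 * (willmore f unitSq * (2 ^ 13 * n)) * (∑ j, energy f j) ^ 2 := by ring
      _ ≤ 1 * (∑ j, energy f j) ^ 2 := by gcongr
      _ = _ := one_mul _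
  rcases Nat.eq_zero_or_pos n with rfl | hn
  · simp
  have hfin : ∑ j, energy f j ≠ ∞ :=
    ENNReal.sum_ne_top.mpr fun i _ => energy_ne_top hf hp i
  have hsum := Finset.sum_le_sum fun i (_ : i ∈ Finset.univ) => hi i
  rw [← Finset.mul_sum, ← Finset.mul_sum] at hsum
  simp only [Finset.sum_const, Finset.card_univ, Fintype.card_fin, nsmul_eq_mul] at hsum
  rw [ENNReal.mul_le_mul_iff_right (by exact_mod_cast hn.ne') (by simp), two_mul] at hsum
  by_contra h0
  exact absurd hsum (not_le.mpr (ENNReal.lt_add_right hfin h0))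

theorem eq_of_energy_eq_zero (hf : Continuous f) (hp : IsPer f) (i : Fin n)
    (h0 : energy f i = 0) (x y : ℝ × ℝ) : f x i = f y i := by
  set c := coef (fun z => cmp i (f z)) 0 with hc
  have hcf : Continuous fun z => cmp i (f z) := (cmp i).continuous.comp hf
  have hk : ∀ k, coef (fun z => cmp i (f z) - c) k = 0 := by
    intro k
    have hsub : coef (fun z => cmp i (f z) - c) k
        = coef (fun z => cmp i (f z)) k - c * coef (fun _ => 1) k := by
      have hch := (contDiff_chr (-k)).continuous
      simp only [coef, mul_sub]
      rw [integral_sub (integrableOn_unitSq (by fun_prop)) (integrableOn_unitSq (by fun_prop)), ← integral_const_mul]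
      congr 2
      funext z
      ring
    rw [hsub, coef_one]
    split_ifs with h
    · rw [h, hc]; ring
    · have := ENNReal.tsum_eq_zero.mp h0 k
      have hw : (wt k : ℝ≥0∞) ≠ 0 := by
        exact_mod_cast fun hw => h (wt_eq_zero.mp hw)
      simpa [hw] using this
  have hcs : Continuous fun z => cmp i (f z) - c := hcf.sub continuous_const
  have hint := tsum_enorm_coef_sq hcs
  simp only [hk, enorm_zero, ne_eq, OfNat.ofNat_ne_zero, not_false_eq_true, zero_pow,
    tsum_zero] at hint
  have hae := (lintegral_eq_zero_iff (hcs.enorm.measurable.pow_const 2)).mp hint.symm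
  have heq : EqOn (fun z => cmp i (f z)) (fun _ => c) unitSq := by
    refine Measure.eqOn_of_ae_eq (μ := volume) ?_ hcf.continuousOn continuousOn_const ?_
    · filter_upwards [hae] with z hz
      simpa [sub_eq_zero] using hz
    · rw [interior_prod_eq, interior_Icc, closure_prod_eq, closure_Ioo zero_ne_one]
  have hall : ∀ x : ℝ × ℝ, cmp i (f x) = c := by
    intro x
    rw [← hp x (-⌊x.1⌋, -⌊x.2⌋)]
    apply heq
    refine ⟨?_, ?_⟩ <;> simp only [Int.cast_neg, ← sub_eq_add_neg, Int.self_sub_floor]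
    · exact ⟨Int.fract_nonneg _, (Int.fract_lt_one _).le⟩
    · exact ⟨Int.fract_nonneg _, (Int.fract_lt_one _).le⟩
  have h := (hall x).trans (hall y).symm
  rw [cmp_apply, cmp_apply] at h
  exact_mod_cast h

end Willmore

end TorusGap

/-- Gap constant (Proposition 2.2, flat torus case). -/
theorem gap_constant_torus (n : ℕ) (hn : 1 ≤ n) (R : ℝ) (hR : 0 < R) :
    ∃ ε₁ > (0:ℝ),
      ∀ f : ℝ × ℝ → EuclideanSpace ℝ (Fin n),
        ContDiff ℝ (⊤ : ℕ∞) f →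
        (∀ (x : ℝ × ℝ) (m : ℤ × ℤ), f (x.1 + (m.1 : ℝ), x.2 + (m.2 : ℝ)) = f x) →
        (∀ x, ‖f x‖ ≤ R) →
        (∀ z, fderiv ℝ f z = 0 → lap f z = 0) →
        willmore f (Icc (0:ℝ) 1 ×ˢ Icc (0:ℝ) 1) < ENNReal.ofReal (ε₁ ^ 2) →
        ∀ x y : ℝ × ℝ, f x = f y := by
  have hn0 : (0 : ℝ) < n := by exact_mod_cast hn
  have hn1 : (1 : ℝ) ≤ n := by exact_mod_cast hn
  refine ⟨1 / (2 ^ 7 * n ^ 2), by positivity, fun f hf hp _ hcrit hW x y => ?_⟩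
  have hf2 : ContDiff ℝ 2 f := hf.of_le (WithTop.coe_le_coe.mpr le_top)
  have hW' : (n : ℝ≥0∞) ^ 2 * (willmore f TorusGap.unitSq * (2 ^ 13 * n)) ≤ 1 := by
    calc _ ≤ (n : ℝ≥0∞) ^ 2 * (ENNReal.ofReal ((1 / (2 ^ 7 * n ^ 2)) ^ 2) * (2 ^ 13 * n)) := by
          gcongr
      _ = ENNReal.ofReal ((n : ℝ) ^ 2 * ((1 / (2 ^ 7 * n ^ 2)) ^ 2 * (2 ^ 13 * n))) := by
          rw [ENNReal.ofReal_mul (by positivity), ENNReal.ofReal_mul (p := (1 / _) ^ 2)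
            (by positivity), ENNReal.ofReal_mul (p := 2 ^ 13) (by positivity),
            ENNReal.ofReal_pow (p := (n : ℝ)) (by positivity), ENNReal.ofReal_natCast]
          simp
      _ ≤ ENNReal.ofReal 1 := by
          apply ENNReal.ofReal_le_ofReal
          have : (n : ℝ) ^ 2 * ((1 / (2 ^ 7 * n ^ 2)) ^ 2 * (2 ^ 13 * n)) = 1 / (2 * n) := by
            field_simp
          rw [this, div_le_one (by positivity)]
          linarith
      _ = 1 := ENNReal.ofReal_one
  have h0 := TorusGap.sum_energy_eq_zero hf2 hp hcrit hW'
  ext i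
  exact TorusGap.eq_of_energy_eq_zero hf.continuous hp i
    (Finset.sum_eq_zero_iff.mp h0 i (Finset.mem_univ i)) x y
end
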